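/- arXiv:2007.02597 — 2 statements merged into one kernel-verified Lean document; each statement's English description precedes it below -/
import Mathlib

section
/- Hadamard–Rybczynski property: For every θ ∈ [0,π], (u₀(e(θ,0)) − v*) · e(θ,0) = 0; equivalently u₀(e(θ,0)) · e(θ,0) = −(4/15) cos θ. Since u₀ is invariant under rotations about the vertical axis e₃, this means that the normal component of u₀ − v* vanishes on the unit sphere ∂B(0,1) (whose outward unit normal at x is n(x) = x). -/
/- Hadamard–Rybczynski property: with u₀(x) = −∫_{B(0,1)} Φ(x−y) e₃ dy and v* = −(4/15) e₃,
   for every θ ∈ [0,π] one has (u₀(e(θ,0)) − v*)·e(θ,0) = 0, equivalently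
   u₀(e(θ,0))·e(θ,0) = −(4/15) cos θ; and the normal component of u₀ − v* vanishes on the unit
   sphere (whose outward unit normal at x is n(x) = x). -/

noncomputable section
open MeasureTheory Real Set Filter RealInnerProductSpace

def V3 (a b c : ℝ) : EuclideanSpace ℝ (Fin 3) := (WithLp.equiv 2 (Fin 3 → ℝ)).symm ![a, b, c]

def e3 : EuclideanSpace ℝ (Fin 3) := V3 0 0 1

/-- Spherical parametrization `e(θ,φ) = (cos φ sin θ, sin φ sin θ, cos θ)`. -/
def eSph (θ φ : ℝ) : EuclideanSpace ℝ (Fin 3) :=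
  V3 (Real.cos φ * Real.sin θ) (Real.sin φ * Real.sin θ) (Real.cos θ)

/-- Oseen tensor `Φ(x) = (8π)⁻¹ (I₃/|x| + x⊗x/|x|³)` applied to a vector `v`. -/
def oseen (x v : EuclideanSpace ℝ (Fin 3)) : EuclideanSpace ℝ (Fin 3) :=
  (8 * π)⁻¹ • (‖x‖⁻¹ • v + (‖x‖ ^ 3)⁻¹ • (⟪x, v⟫ • x))

/-- `u₀(x) = −∫_{B(0,1)} Φ(x−y) e₃ dy`. -/
def u0 (x : EuclideanSpace ℝ (Fin 3)) : EuclideanSpace ℝ (Fin 3) :=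
  -∫ y in Metric.ball (0 : EuclideanSpace ℝ (Fin 3)) 1, oseen (x - y) e3

/-- `v* = −(4/15) e₃`. -/
def vstar : EuclideanSpace ℝ (Fin 3) := (-(4 / 15) : ℝ) • e3


abbrev E2 := EuclideanSpace ℝ (Fin 2)
abbrev E3 := EuclideanSpace ℝ (Fin 3)

lemma inner_int (s : ℝ) (hs : 0 < s) (hs2 : s < 2) :
    ∫ ρ in (0:ℝ)..√(2*s - s^2), ρ * ((√(s^2+ρ^2))⁻¹ + ((√(s^2+ρ^2))^3)⁻¹ * s^2)
      = √(2*s) - s * √(2*s) / 2 := by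
  have hpos : ∀ ρ : ℝ, 0 < s^2 + ρ^2 := fun ρ => by positivity
  rw [intervalIntegral.integral_eq_sub_of_hasDerivAt
    (f := fun ρ => √(s^2+ρ^2) - s^2 * (√(s^2+ρ^2))⁻¹)]
  · have h1 : 0 ≤ 2*s - s^2 := by nlinarith
    have h2 : s^2 + (2*s - s^2) = 2*s := by ring
    simp only [Real.sq_sqrt h1, h2]
    have h3 : √(s^2 + 0^2) = s := by rw [zero_pow two_ne_zero, add_zero, Real.sqrt_sq hs.le]
    rw [h3]
    have h4 : √(2*s) ^ 2 = 2*s := Real.sq_sqrt (by positivity)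
    have h5 : 0 < √(2*s) := Real.sqrt_pos.2 (by positivity)
    field_simp
    rw [h4]; ring
  · intro ρ _
    have h5 : 0 < √(s^2+ρ^2) := Real.sqrt_pos.2 (hpos ρ)
    have h := (((hasDerivAt_id ρ).pow 2).const_add (s^2)).sqrt (hpos ρ).ne'
    have h' := h.sub ((h.inv h5.ne').const_mul (s^2))
    convert! h' using 1
    simp
    field_simp
    try ring
  · apply Continuous.intervalIntegrable
    have : ∀ ρ, √(s^2+ρ^2) ≠ 0 := fun ρ => (Real.sqrt_pos.2 (hpos ρ)).ne'
    have h3 : ∀ ρ, √(s^2+ρ^2)^3 ≠ 0 := fun ρ => pow_ne_zero _ (this ρ)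
    fun_prop (disch := assumption)

lemma outer_int : ∫ s in (0:ℝ)..2, (√(2*s) - s * √(2*s) / 2) = 16/15 := by
  rw [intervalIntegral.integral_eq_sub_of_hasDerivAt_of_le (by norm_num)
    (f := fun s => 2/3 * (s * √(2*s)) - 1/5 * (s^2 * √(2*s)))]
  · have : √((2:ℝ)*2) = 2 := by rw [show (2:ℝ)*2 = 2^2 by norm_num]; exact Real.sqrt_sq (by norm_num)
    simp [this]; norm_num
  · fun_prop
  · intro s hs
    have h2 : 0 < 2 * s := by linarith [hs.1]
    have h5 : 0 < √(2*s) := Real.sqrt_pos.2 h2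
    have h := ((hasDerivAt_id s).const_mul 2).sqrt h2.ne'
    have h' := (((hasDerivAt_id s).mul h).const_mul (2/3)).sub
      ((((hasDerivAt_id s).pow 2).mul h).const_mul (1/5))
    convert! h' using 1
    have h4 : √(2*s) ^ 2 = 2*s := Real.sq_sqrt h2.le
    simp only [id, Pi.pow_apply, mul_one, Nat.cast_ofNat, one_mul]
    field_simp
    rw [h4]; ring
  · apply Continuous.intervalIntegrable; fun_prop

def fs (s ρ : ℝ) : ℝ :=
  if s^2 + ρ^2 < 2*s then (√(s^2+ρ^2))⁻¹ + ((√(s^2+ρ^2))^3)⁻¹ * s^2 else 0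

lemma plane_int (s : ℝ) : ∫ w : E2, fs s ‖w‖ =
    (Ioo (0:ℝ) 2).indicator (fun s => 2 * π * (√(2*s) - s * √(2*s) / 2)) s := by
  by_cases h : s ∈ Ioo (0:ℝ) 2
  · rw [indicator_of_mem h, integral_fun_norm_addHaar]
    have hv : (volume : Measure E2).real (Metric.ball 0 1) = π := by
      simp [Measure.real, Real.pi_pos.le]
    have hn : 0 ≤ 2*s - s^2 := by nlinarith [h.1, h.2]
    rw [hv, ← inner_int s h.1 h.2, intervalIntegral.integral_of_le (Real.sqrt_nonneg _),
      integral_Ioc_eq_integral_Ioo, ← integral_indicator measurableSet_Ioo,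
      ← integral_indicator measurableSet_Ioi]
    have : (Ioi (0:ℝ)).indicator (fun y => y ^ (Module.finrank ℝ E2 - 1) • fs s y) =
      (Ioo 0 √(2*s - s^2)).indicator
        (fun ρ => ρ * ((√(s^2+ρ^2))⁻¹ + ((√(s^2+ρ^2))^3)⁻¹ * s^2)) := by
      ext ρ
      by_cases h0 : 0 < ρ
      · have : ρ < √(2*s - s^2) ↔ s^2 + ρ^2 < 2*s := by
          rw [Real.lt_sqrt h0.le]; constructor <;> intro h <;> linarith
        by_cases h1 : s^2 + ρ^2 < 2*s
        · rw [indicator_of_mem (show ρ ∈ Ioi 0 from h0), indicator_of_mem (show ρ ∈ Ioo 0 _ from ⟨h0, this.2 h1⟩)]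
          simp [fs, h1]
        · rw [indicator_of_mem (show ρ ∈ Ioi 0 from h0),
            indicator_of_notMem (fun hh => h1 (this.1 hh.2))]
          simp [fs, h1]
      · rw [indicator_of_notMem (show ρ ∉ Ioi 0 from h0), indicator_of_notMem (fun hh => h0 hh.1)]
    rw [this]
    simp; ring
  · rw [indicator_of_notMem h]
    have : ∀ w : E2, fs s ‖w‖ = 0 := fun w => by
      rw [fs, if_neg]
      intro hh
      apply h
      constructor <;> nlinarith [sq_nonneg ‖w‖, sq_nonneg s]
    simp [this]

lemma total_int : ∫ s : ℝ, ∫ w : E2, fs s ‖w‖ = 32 * π / 15 := by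
  simp_rw [plane_int]
  rw [integral_indicator measurableSet_Ioo, ← integral_Ioc_eq_integral_Ioo,
    ← intervalIntegral.integral_of_le (by norm_num), intervalIntegral.integral_const_mul, outer_int]
  ring

/-- cylindrical splitting -/
def cyl : E3 ≃ᵐ ℝ × E2 :=
  (MeasurableEquiv.toLp 2 (Fin 3 → ℝ)).symm.trans
    ((MeasurableEquiv.piFinSuccAbove (fun _ : Fin 3 => ℝ) 0).trans
      ((MeasurableEquiv.refl ℝ).prodCongr (MeasurableEquiv.toLp 2 (Fin 2 → ℝ))))

lemma cyl_mp : MeasurePreserving cyl := by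
  refine MeasurePreserving.trans (PiLp.volume_preserving_ofLp (Fin 3))
    (MeasurePreserving.trans (volume_preserving_piFinSuccAbove (fun _ : Fin 3 => ℝ) 0) ?_)
  exact (MeasurePreserving.id volume).prod (PiLp.volume_preserving_toLp (Fin 2))

lemma cyl_norm (z : E3) : ‖z‖^2 = (cyl z).1^2 + ‖(cyl z).2‖^2 := by
  rw [EuclideanSpace.real_norm_sq_eq, EuclideanSpace.real_norm_sq_eq, Fin.sum_univ_succ]
  rfl

lemma cyl_fst (z : E3) : (cyl z).1 = z 0 := rfl

/-- integrability of 1/|z| on balls -/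
lemma integrableOn_inv_norm (x : E3) : IntegrableOn (fun z : E3 => ‖z‖⁻¹) (Metric.ball x 1) := by
  have : IntegrableOn (fun z : E3 => ‖z‖⁻¹) (Metric.ball 0 (‖x‖ + 1)) := by
    rw [integrableOn_fun_norm_addHaar volume (f := fun r => r⁻¹)]
    have h : IntegrableOn (fun y : ℝ => y) (Ioo 0 (‖x‖+1)) :=
      (continuous_id.integrableOn_Icc (a := 0) (b := ‖x‖+1)).mono_set Ioo_subset_Icc_self
    refine h.congr_fun ?_ measurableSet_Ioo
    intro y hy
    have := hy.1
    simp
    field_simp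
  refine this.mono_set (Metric.ball_subset_ball' ?_)
  simp [add_comm]

lemma integrableOn_quad (x a b : E3) :
    IntegrableOn (fun z : E3 => (‖z‖^3)⁻¹ * (⟪z, a⟫ * ⟪z, b⟫)) (Metric.ball x 1) := by
  refine Integrable.mono' ((integrableOn_inv_norm x).mul_const (‖a‖ * ‖b‖)) ?_ ?_
  · apply Measurable.aestronglyMeasurable
    fun_prop
  · refine Eventually.of_forall fun z => ?_
    rcases eq_or_ne z 0 with rfl | hz
    · simp
    have hz' : 0 < ‖z‖ := norm_pos_iff.2 hz
    rw [norm_mul, norm_mul, norm_inv, norm_pow, norm_norm]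
    have h1 := norm_inner_le_norm (𝕜 := ℝ) z a
    have h2 := norm_inner_le_norm (𝕜 := ℝ) z b
    calc (‖z‖^3)⁻¹ * (‖⟪z, a⟫‖ * ‖⟪z, b⟫‖) ≤ (‖z‖^3)⁻¹ * ((‖z‖*‖a‖) * (‖z‖*‖b‖)) := by gcongr
      _ = ‖z‖⁻¹ * (‖a‖ * ‖b‖) := by field_simp

def GG (x z : E3) : ℝ := ‖z‖⁻¹ + (‖z‖^3)⁻¹ * (⟪z, x⟫ * ⟪z, x⟫)

lemma integrableOn_GG (x : E3) : IntegrableOn (GG x) (Metric.ball x 1) :=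
  (integrableOn_inv_norm x).add (integrableOn_quad x x x)

lemma mem_ball_iff' (x z : E3) (hx : ‖x‖ = 1) : z ∈ Metric.ball x 1 ↔ ‖z‖^2 < 2 * ⟪z, x⟫ := by
  rw [mem_ball_iff_norm, ← sq_lt_one_iff₀ (norm_nonneg _), norm_sub_sq_real, hx]
  constructor <;> intro h <;> linarith

def ax : E3 := EuclideanSpace.single 0 1

lemma ax_norm : ‖ax‖ = 1 := by simp [ax]

lemma base_indicator : (Metric.ball ax 1).indicator (GG ax) =
    fun z => (fun p : ℝ × E2 => fs p.1 ‖p.2‖) (cyl z) := by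
  ext z
  have hi : ⟪z, ax⟫ = (cyl z).1 := by
    rw [cyl_fst]; simp [ax, EuclideanSpace.inner_single_right]
  have hn : ‖z‖ = √((cyl z).1^2 + ‖(cyl z).2‖^2) := by
    rw [← cyl_norm, Real.sqrt_sq (norm_nonneg _)]
  have hm := mem_ball_iff' ax z ax_norm
  rw [cyl_norm, hi] at hm
  by_cases h : z ∈ Metric.ball ax 1
  · rw [indicator_of_mem h]
    simp only [GG, fs, if_pos (hm.1 h), hi, ← hn]
    ring
  · rw [indicator_of_notMem h]
    simp only [fs, if_neg (fun hh => h (hm.2 hh))]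

lemma base_int : ∫ z in Metric.ball ax 1, GG ax z = 32 * π / 15 := by
  have hi := (integrable_indicator_iff Metric.isOpen_ball.measurableSet).2 (integrableOn_GG ax)
  rw [base_indicator] at hi
  have hi' : Integrable (fun p : ℝ × E2 => fs p.1 ‖p.2‖) :=
    (cyl_mp.integrable_comp_emb cyl.measurableEmbedding).1 hi
  rw [← integral_indicator Metric.isOpen_ball.measurableSet, base_indicator,
    cyl_mp.integral_comp cyl.measurableEmbedding, ← total_int, Measure.volume_eq_prod,
    integral_prod _ hi']

lemma int_iso (R : E3 ≃ₗᵢ[ℝ] E3) (x : E3) (f : E3 → ℝ) :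
    ∫ z in Metric.ball x 1, f (R z) = ∫ z in Metric.ball (R x) 1, f z := by
  rw [← R.measurePreserving.setIntegral_preimage_emb R.toMeasurableEquiv.measurableEmbedding f
    (Metric.ball (R x) 1)]
  congr 2
  ext z
  simp

lemma gen_int (x : E3) (hx : ‖x‖ = 1) : ∫ z in Metric.ball x 1, GG x z = 32 * π / 15 := by
  set R := (ℝ ∙ (x - ax))ᗮ.reflection
  have hR : R x = ax := Submodule.reflection_sub (by rw [hx, ax_norm])
  rw [← base_int, ← hR, ← int_iso]
  congr 1
  ext z
  simp only [GG, LinearIsometryEquiv.norm_map, LinearIsometryEquiv.inner_map_map]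

lemma odd_int (x w : E3) (hw : ⟪x, w⟫ = 0) :
    ∫ z in Metric.ball x 1, (‖z‖^3)⁻¹ * (⟪z, w⟫ * ⟪z, x⟫) = 0 := by
  set R := (ℝ ∙ x).reflection
  have hR : R x = x := Submodule.reflection_mem_subspace_eq_self (Submodule.mem_span_singleton_self x)
  have hRw : R w = -w := Submodule.reflection_mem_subspace_orthogonalComplement_eq_neg
    (Submodule.mem_orthogonal_singleton_iff_inner_right.2 hw)
  have h := int_iso R x (fun z => (‖z‖^3)⁻¹ * (⟪z, w⟫ * ⟪z, x⟫))
  rw [hR] at h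
  have : ∀ z, (‖R z‖^3)⁻¹ * (⟪R z, w⟫ * ⟪R z, x⟫) = - ((‖z‖^3)⁻¹ * (⟪z, w⟫ * ⟪z, x⟫)) := by
    intro z
    have h1 : ⟪R z, x⟫ = ⟪z, x⟫ := by
      conv_lhs => rw [← hR]
      exact R.inner_map_map z x
    have h2 : ⟪R z, w⟫ = -⟪z, w⟫ := by
      have := R.inner_map_map z w
      rw [hRw, inner_neg_right] at this
      linarith
    rw [h1, h2, R.norm_map]; ring
  simp_rw [this] at h
  rw [integral_neg] at h
  linarith

lemma oseen_meas (v : E3) : Measurable (fun z : E3 => oseen z v) := by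
  unfold oseen
  fun_prop

lemma oseen_integrable (x : E3) : IntegrableOn (fun z : E3 => oseen z e3) (Metric.ball x 1) := by
  refine Integrable.mono' ((integrableOn_inv_norm x).mul_const ((8*π)⁻¹ * (2*‖e3‖)))
    (oseen_meas e3).aestronglyMeasurable (Eventually.of_forall fun z => ?_)
  rcases eq_or_ne z 0 with rfl | hz
  · simp [oseen]
  have hz' : 0 < ‖z‖ := norm_pos_iff.2 hz
  have h1 := norm_inner_le_norm (𝕜 := ℝ) z e3
  have hp := Real.pi_pos
  rw [oseen, norm_smul, Real.norm_of_nonneg (by positivity)]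
  calc (8*π)⁻¹ * ‖‖z‖⁻¹ • e3 + (‖z‖^3)⁻¹ • (⟪z, e3⟫ • z)‖
      ≤ (8*π)⁻¹ * (‖z‖⁻¹ * ‖e3‖ + (‖z‖^3)⁻¹ * ((‖z‖ * ‖e3‖) * ‖z‖)) := by
        gcongr
        refine (norm_add_le _ _).trans ?_
        rw [norm_smul, norm_smul, norm_smul, norm_inv, norm_inv, norm_pow, norm_norm]
        gcongr
    _ = _ := by field_simp; ring

lemma u0_eq (x : E3) : u0 x = -∫ z in Metric.ball x 1, oseen z e3 := by
  rw [u0, ← integral_indicator Metric.isOpen_ball.measurableSet,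
    ← integral_indicator Metric.isOpen_ball.measurableSet, ← integral_sub_left_eq_self
      ((Metric.ball x 1).indicator fun z => oseen z e3) _ x]
  congr 2
  ext1 y
  by_cases h : y ∈ Metric.ball (0:E3) 1
  · rw [indicator_of_mem h, indicator_of_mem (by simpa [dist_eq_norm] using h)]
  · rw [indicator_of_notMem h, indicator_of_notMem (by simpa [dist_eq_norm] using h)]

lemma normal_u0 (x : E3) (hx : ‖x‖ = 1) : ⟪u0 x, x⟫ = -(4/15) * ⟪e3, x⟫ := by
  have hp := Real.pi_pos
  set c := ⟪e3, x⟫ with hc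
  set w := e3 - c • x with hw
  have hxx : ⟪x, x⟫ = 1 := by rw [real_inner_self_eq_norm_sq, hx]; norm_num
  have hxw : ⟪x, w⟫ = 0 := by
    rw [hw, inner_sub_right, inner_smul_right, hxx, real_inner_comm, ← hc]; ring
  have he : e3 = c • x + w := by rw [hw]; abel
  have key : ∀ z, ⟪x, oseen z e3⟫ =
      (8*π)⁻¹ * (c * GG x z + (‖z‖^3)⁻¹ * (⟪z, w⟫ * ⟪z, x⟫)) := by
    intro z
    have h1 : ⟪z, e3⟫ = c * ⟪z, x⟫ + ⟪z, w⟫ := by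
      conv_lhs => rw [he]
      rw [inner_add_right, inner_smul_right]
    rw [oseen, inner_smul_right, inner_add_right, inner_smul_right, inner_smul_right,
      inner_smul_right, h1, real_inner_comm e3 x, ← hc, real_inner_comm z x, GG]
    ring
  rw [u0_eq, inner_neg_left, real_inner_comm, ← integral_inner (oseen_integrable x)]
  simp_rw [key]
  rw [integral_const_mul, integral_add ((integrableOn_GG x).const_mul c) (integrableOn_quad x w x),
    integral_const_mul, gen_int x hx, odd_int x w hxw]
  field_simp
  ring

lemma sphere_zero (x : E3) (hx : ‖x‖ = 1) : ⟪u0 x - vstar, x⟫ = 0 := by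
  rw [inner_sub_left, normal_u0 x hx, vstar, real_inner_smul_left]
  ring

lemma eSph_norm (θ : ℝ) : ‖eSph θ 0‖ = 1 := by
  rw [EuclideanSpace.norm_eq]
  simp [eSph, V3, Fin.sum_univ_three]

lemma e3_eSph (θ : ℝ) : ⟪e3, eSph θ 0⟫ = Real.cos θ := by
  simp [e3, eSph, V3, PiLp.inner_apply, Fin.sum_univ_three]

theorem hadamard_rybczynski_property :
    (∀ θ ∈ Set.Icc (0 : ℝ) π,
      ⟪u0 (eSph θ 0) - vstar, eSph θ 0⟫ = 0 ∧
      ⟪u0 (eSph θ 0), eSph θ 0⟫ = -(4 / 15) * Real.cos θ) ∧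
    (∀ x ∈ Metric.sphere (0 : EuclideanSpace ℝ (Fin 3)) 1, ⟪u0 x - vstar, x⟫ = 0) := by
  refine ⟨fun θ _ => ⟨sphere_zero _ (eSph_norm θ), ?_⟩, fun x hx => sphere_zero x (by simpa using hx)⟩
  rw [normal_u0 _ (eSph_norm θ), e3_eSph]
end
end

section
/- Well-posedness estimate for the steady Stokes equation on ℝ³: Let η ∈ L¹(ℝ³;ℝ³) ∩ L∞(ℝ³;ℝ³). Then u(x) = ∫_{ℝ³} Φ(x−y) η(y) dy is well defined for every x ∈ ℝ³, u ∈ W^{1,∞}(ℝ³;ℝ³), u(x) → 0 as |x| → ∞, div u = 0 in the sense of distributions, and for every divergence-free φ ∈ C_c^∞(ℝ³;ℝ³) one has ∫ ∇u : ∇φ = ∫ η · φ (i.e. u solves −Δu + ∇p = η, div u = 0 weakly). Moreover there is a constant C > 0 independent of η such that ‖u‖_∞ + ‖∇u‖_∞ ≤ C (‖η‖_{L¹} + ‖η‖_{L∞}). -/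
/- Well-posedness estimate for the steady Stokes equation on ℝ³: for η ∈ L¹ ∩ L∞ (vector
   valued, with ‖η‖_∞ ≤ M a.e.), u(x) = ∫ Φ(x−y) η(y) dy is well defined for every x,
   u ∈ W^{1,∞}, u(x) → 0 as |x| → ∞, div u = 0 distributionally, u solves −Δu + ∇p = η,
   div u = 0 weakly (∫ ∇u : ∇φ = ∫ η·φ for divergence-free test fields φ), and
   ‖u‖_∞ + ‖∇u‖_∞ ≤ C (‖η‖_{L¹} + ‖η‖_{L∞}) with C independent of η. -/

noncomputable section
open MeasureTheory Real Set Filter RealInnerProductSpace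

/-- Divergence of a vector field on `ℝ³`. -/
def divg (F : EuclideanSpace ℝ (Fin 3) → EuclideanSpace ℝ (Fin 3))
    (y : EuclideanSpace ℝ (Fin 3)) : ℝ :=
  ∑ i : Fin 3, ⟪fderiv ℝ F y (EuclideanSpace.single i 1), EuclideanSpace.single i 1⟫

/-- The Oseen potential of a vector-valued source term. -/
def oseenPot (η : EuclideanSpace ℝ (Fin 3) → EuclideanSpace ℝ (Fin 3))
    (x : EuclideanSpace ℝ (Fin 3)) : EuclideanSpace ℝ (Fin 3) :=
  ∫ y, oseen (x - y) (η y)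


abbrev EE := EuclideanSpace ℝ (Fin 3)

/-! ### Kernel integrability -/

lemma st_finrank : Module.finrank ℝ EE = 3 := by simp

lemma st_ker_int {p : ℕ} (hp : p ≤ 2) (r : ℝ) :
    IntegrableOn (fun z : EE => (‖z‖ ^ p)⁻¹) (Metric.ball 0 r) := by
  rw [integrableOn_fun_norm_addHaar volume (f := fun t : ℝ => (t ^ p)⁻¹)]
  have h : IntegrableOn (fun y : ℝ => y ^ (2 - p)) (Ioo 0 r) :=
    ((continuous_pow (2 - p)).integrableOn_Icc (a := 0) (b := r)).mono_set Ioo_subset_Icc_self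
  refine h.congr_fun (fun y hy => ?_) measurableSet_Ioo
  have hy0 : y ≠ 0 := hy.1.ne'
  simp only [st_finrank, smul_eq_mul]
  rw [← div_eq_mul_inv, show (3 - 1 : ℕ) = (2 - p) + p by omega, pow_add]
  field_simp

/-- the near-field kernel -/
def stk (p : ℕ) (z : EE) : ℝ := (Metric.ball (0 : EE) 1).indicator (fun z => (‖z‖ ^ p)⁻¹) z

def stκ (p : ℕ) : ℝ := ∫ z, stk p z

lemma stk_int {p : ℕ} (hp : p ≤ 2) : Integrable (stk p) :=
  (integrable_indicator_iff measurableSet_ball).2 (st_ker_int hp 1)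

lemma stk_nonneg (p : ℕ) (z : EE) : 0 ≤ stk p z :=
  Set.indicator_nonneg (fun _ _ => by positivity) _

lemma stκ_nonneg (p : ℕ) : 0 ≤ stκ p := integral_nonneg (stk_nonneg p)

lemma st_inv_le (p : ℕ) (z : EE) : (‖z‖ ^ p)⁻¹ ≤ stk p z + 1 := by
  by_cases h : z ∈ Metric.ball (0 : EE) 1
  · simp [stk, h]
  · have h1 : 1 ≤ ‖z‖ := by simpa using h
    simp only [stk, Set.indicator_of_notMem h, zero_add]
    exact inv_le_one_of_one_le₀ (one_le_pow₀ h1)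

lemma st_M_nonneg {η : EE → EE} {M : ℝ} (hM : ∀ᵐ x, ‖η x‖ ≤ M) : 0 ≤ M := by
  obtain ⟨x, hx⟩ := hM.exists
  exact (norm_nonneg _).trans hx

lemma st_near_int {p : ℕ} (hp : p ≤ 2) (x : EE) : Integrable (fun y => stk p (x - y)) :=
  (stk_int hp).comp_sub_left x

lemma st_near_integral (p : ℕ) (x : EE) : ∫ y, stk p (x - y) = stκ p :=
  integral_sub_left_eq_self (stk p) volume x

lemma st_conv_meas (p : ℕ) {η : EE → EE} (hη : Integrable η) (x : EE) :
    AEStronglyMeasurable (fun y => (‖x - y‖ ^ p)⁻¹ * ‖η y‖) := by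
  refine AEStronglyMeasurable.mul ?_ hη.aestronglyMeasurable.norm
  exact (by fun_prop : Measurable fun y : EE => (‖x - y‖ ^ p)⁻¹).aestronglyMeasurable

lemma st_conv_le {p : ℕ} {η : EE → EE} {M : ℝ} (hM : ∀ᵐ x, ‖η x‖ ≤ M) (x : EE) :
    ∀ᵐ y, (‖x - y‖ ^ p)⁻¹ * ‖η y‖ ≤ M * stk p (x - y) + ‖η y‖ := by
  filter_upwards [hM] with y hy
  have h1 := st_inv_le p (x - y)
  have h2 := stk_nonneg p (x - y)
  have h3 := norm_nonneg (η y)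
  nlinarith

lemma st_conv_int {p : ℕ} (hp : p ≤ 2) {η : EE → EE} {M : ℝ} (hη : Integrable η)
    (hM : ∀ᵐ x, ‖η x‖ ≤ M) (x : EE) : Integrable (fun y => (‖x - y‖ ^ p)⁻¹ * ‖η y‖) := by
  refine Integrable.mono' (((st_near_int hp x).const_mul M).add hη.norm)
    (st_conv_meas p hη x) ?_
  filter_upwards [st_conv_le (p := p) hM x] with y hy
  rw [Real.norm_of_nonneg (by positivity)]
  exact hy

lemma st_conv_bound {p : ℕ} (hp : p ≤ 2) {η : EE → EE} {M : ℝ} (hη : Integrable η)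
    (hM : ∀ᵐ x, ‖η x‖ ≤ M) (x : EE) :
    ∫ y, (‖x - y‖ ^ p)⁻¹ * ‖η y‖ ≤ M * stκ p + ∫ y, ‖η y‖ := by
  calc _ ≤ ∫ y, (M * stk p (x - y) + ‖η y‖) :=
        integral_mono_ae (st_conv_int hp hη hM x)
          (((st_near_int hp x).const_mul M).add hη.norm) (st_conv_le hM x)
    _ = _ := by
        rw [integral_add ((st_near_int hp x).const_mul M) hη.norm, integral_const_mul,
          st_near_integral]

/-! ### Pointwise bounds on the Oseen tensor -/

lemma st_pi_bound : (8 * π)⁻¹ * 2 ≤ 1 := by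
  have := Real.pi_gt_three
  rw [inv_mul_le_iff₀ (by positivity)]
  linarith

lemma st_rank_one (x v : EE) : ‖(‖x‖ ^ 3)⁻¹ • (⟪x, v⟫ • x)‖ ≤ ‖x‖⁻¹ * ‖v‖ := by
  rcases eq_or_ne x 0 with rfl | hx
  · simp
  have hx' : 0 < ‖x‖ := norm_pos_iff.2 hx
  rw [norm_smul, norm_smul, Real.norm_of_nonneg (by positivity)]
  have := abs_real_inner_le_norm x v
  rw [Real.norm_eq_abs]
  calc (‖x‖ ^ 3)⁻¹ * (|⟪x, v⟫| * ‖x‖) ≤ (‖x‖ ^ 3)⁻¹ * ((‖x‖ * ‖v‖) * ‖x‖) := by gcongr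
    _ = _ := by field_simp

lemma st_oseen_le (x v : EE) : ‖oseen x v‖ ≤ ‖x‖⁻¹ * ‖v‖ := by
  have h1 := st_rank_one x v
  have h2 : ‖‖x‖⁻¹ • v‖ = ‖x‖⁻¹ * ‖v‖ := by rw [norm_smul, norm_inv, norm_norm]
  have h3 := norm_add_le (‖x‖⁻¹ • v) ((‖x‖ ^ 3)⁻¹ • (⟪x, v⟫ • x))
  have hp : 0 < (8 * π)⁻¹ := by positivity
  unfold oseen
  rw [norm_smul, Real.norm_of_nonneg hp.le]
  have h4 : 0 ≤ ‖x‖⁻¹ * ‖v‖ := by positivity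
  calc _ ≤ (8 * π)⁻¹ * (2 * (‖x‖⁻¹ * ‖v‖)) := by gcongr; linarith
    _ = ((8 * π)⁻¹ * 2) * (‖x‖⁻¹ * ‖v‖) := by ring
    _ ≤ 1 * (‖x‖⁻¹ * ‖v‖) := by gcongr; exact st_pi_bound
    _ = _ := one_mul _

lemma st_inv_sub {s t : ℝ} (hs : 0 < s) (ht : 0 < t) : |s⁻¹ - t⁻¹| = |s - t| * (s⁻¹ * t⁻¹) := by
  have : s⁻¹ - t⁻¹ = (t - s) * (s⁻¹ * t⁻¹) := by field_simp
  rw [this, abs_mul, abs_sub_comm, abs_of_pos (by positivity : 0 < s⁻¹ * t⁻¹)]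

lemma st_oseen_sub_aux (a b v : EE) (ha : a ≠ 0) (hb : b ≠ 0) :
    ‖oseen a v - oseen b v‖ ≤ 6 * ‖a - b‖ * (‖a‖⁻¹ * ‖b‖⁻¹) * ‖v‖ := by
  have ha' : 0 < ‖a‖ := norm_pos_iff.2 ha
  have hb' : 0 < ‖b‖ := norm_pos_iff.2 hb
  set s := ‖a‖ with hs
  set t := ‖b‖ with ht
  set d := ‖a - b‖ with hd
  have hst : |s - t| ≤ d := abs_norm_sub_norm_le a b
  have hi : |s⁻¹ - t⁻¹| ≤ d * (s⁻¹ * t⁻¹) := by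
    rw [st_inv_sub ha' hb']; gcongr
  set α : EE := s⁻¹ • a with hα
  set β : EE := t⁻¹ • b with hβ
  have hαn : ‖α‖ = 1 := by
    rw [hα, norm_smul, norm_inv, Real.norm_of_nonneg ha'.le, ← hs, inv_mul_cancel₀ ha'.ne']
  have hβn : ‖β‖ = 1 := by
    rw [hβ, norm_smul, norm_inv, Real.norm_of_nonneg hb'.le, ← ht, inv_mul_cancel₀ hb'.ne']
  have hαβ : ‖α - β‖ ≤ 2 * d * s⁻¹ := by
    have e : α - β = s⁻¹ • (a - b) + (s⁻¹ - t⁻¹) • b := by rw [hα, hβ]; module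
    rw [e]
    refine (norm_add_le _ _).trans ?_
    rw [norm_smul, norm_smul, ← hd, ← ht, Real.norm_of_nonneg (by positivity : 0 ≤ s⁻¹),
      Real.norm_eq_abs]
    have : |s⁻¹ - t⁻¹| * t ≤ d * (s⁻¹ * t⁻¹) * t := by gcongr
    have e2 : d * (s⁻¹ * t⁻¹) * t = d * s⁻¹ := by field_simp
    linarith
  have ea : oseen a v = (8 * π)⁻¹ • (s⁻¹ • (v + ⟪α, v⟫ • α)) := by
    rw [oseen, hα, real_inner_smul_left]
    simp only [smul_add, smul_smul]
    rw [← hs]; congr 2; field_simp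
  have eb : oseen b v = (8 * π)⁻¹ • (t⁻¹ • (v + ⟪β, v⟫ • β)) := by
    rw [oseen, hβ, real_inner_smul_left]
    simp only [smul_add, smul_smul]
    rw [← ht]; congr 2; field_simp
  have key : oseen a v - oseen b v = (8 * π)⁻¹ • ((s⁻¹ - t⁻¹) • (v + ⟪α, v⟫ • α)
      + t⁻¹ • (⟪α - β, v⟫ • α + ⟪β, v⟫ • (α - β))) := by
    rw [ea, eb, inner_sub_left]; module
  clear_value α β
  have n1 : ‖v + ⟪α, v⟫ • α‖ ≤ 2 * ‖v‖ := by
    refine (norm_add_le _ _).trans ?_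
    rw [norm_smul, hαn, mul_one, Real.norm_eq_abs]
    have := abs_real_inner_le_norm α v
    rw [hαn] at this; linarith
  have n2 : ‖⟪α - β, v⟫ • α + ⟪β, v⟫ • (α - β)‖ ≤ 2 * (2 * d * s⁻¹) * ‖v‖ := by
    refine (norm_add_le _ _).trans ?_
    rw [norm_smul, norm_smul, hαn, mul_one, Real.norm_eq_abs, Real.norm_eq_abs]
    have h1 := abs_real_inner_le_norm (α - β) v
    have h2 := abs_real_inner_le_norm β v
    rw [hβn, one_mul] at h2
    have h3 : |⟪β, v⟫| * ‖α - β‖ ≤ ‖v‖ * ‖α - β‖ := by gcongr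
    have h4 : ‖α - β‖ * ‖v‖ ≤ 2 * d * s⁻¹ * ‖v‖ := by gcongr
    linarith
  rw [key, norm_smul, Real.norm_of_nonneg (by positivity : 0 ≤ (8 * π)⁻¹)]
  have n3 : ‖(s⁻¹ - t⁻¹) • (v + ⟪α, v⟫ • α)
      + t⁻¹ • (⟪α - β, v⟫ • α + ⟪β, v⟫ • (α - β))‖ ≤ 6 * d * (s⁻¹ * t⁻¹) * ‖v‖ := by
    refine (norm_add_le _ _).trans ?_
    rw [norm_smul, norm_smul, Real.norm_eq_abs, Real.norm_of_nonneg (by positivity : 0 ≤ t⁻¹)]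
    have h1 : |s⁻¹ - t⁻¹| * ‖v + ⟪α, v⟫ • α‖ ≤ (d * (s⁻¹ * t⁻¹)) * (2 * ‖v‖) := by gcongr
    have h2 : t⁻¹ * ‖⟪α - β, v⟫ • α + ⟪β, v⟫ • (α - β)‖ ≤ t⁻¹ * (2 * (2 * d * s⁻¹) * ‖v‖) := by
      gcongr
    linarith
  have hp : (8 * π)⁻¹ ≤ 1 := by
    have := st_pi_bound
    have : 0 < (8 * π)⁻¹ := by positivity
    linarith
  calc _ ≤ 1 * (6 * d * (s⁻¹ * t⁻¹) * ‖v‖) := by gcongr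
    _ = _ := one_mul _

lemma st_oseen_sub (a b v : EE) (ha : a ≠ 0) (hb : b ≠ 0) :
    ‖oseen a v - oseen b v‖ ≤ 3 * ‖a - b‖ * ((‖a‖ ^ 2)⁻¹ * ‖v‖ + (‖b‖ ^ 2)⁻¹ * ‖v‖) := by
  refine (st_oseen_sub_aux a b v ha hb).trans ?_
  have h : 2 * (‖a‖⁻¹ * ‖b‖⁻¹) ≤ (‖a‖ ^ 2)⁻¹ + (‖b‖ ^ 2)⁻¹ := by
    rw [← inv_pow, ← inv_pow]; nlinarith [sq_nonneg (‖a‖⁻¹ - ‖b‖⁻¹)]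
  calc _ = 3 * ‖a - b‖ * ((2 * (‖a‖⁻¹ * ‖b‖⁻¹)) * ‖v‖) := by ring
    _ ≤ 3 * ‖a - b‖ * (((‖a‖ ^ 2)⁻¹ + (‖b‖ ^ 2)⁻¹) * ‖v‖) := by gcongr
    _ = _ := by ring

lemma st_oseen_meas : Measurable (fun q : EE × EE => oseen q.1 q.2) := by
  unfold oseen; fun_prop

/-! ### The potential -/

lemma st_pot_int {η : EE → EE} {M : ℝ} (hη : Integrable η)
    (hM : ∀ᵐ x, ‖η x‖ ≤ M) (x : EE) : Integrable (fun y => oseen (x - y) (η y)) := by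
  refine Integrable.mono' (st_conv_int (p := 1) (by norm_num) hη hM x) ?_ ?_
  · have : AEMeasurable (fun y => (x - y, η y)) :=
      (by fun_prop : Measurable fun y : EE => x - y).aemeasurable.prodMk
        hη.aestronglyMeasurable.aemeasurable
    exact (st_oseen_meas.comp_aemeasurable this).aestronglyMeasurable
  · filter_upwards with y
    simpa using st_oseen_le (x - y) (η y)

lemma st_pot_le_int {η : EE → EE} {M : ℝ} (hη : Integrable η)
    (hM : ∀ᵐ x, ‖η x‖ ≤ M) (x : EE) :
    ‖oseenPot η x‖ ≤ ∫ y, (‖x - y‖ ^ 1)⁻¹ * ‖η y‖ := by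
  refine norm_integral_le_of_norm_le (st_conv_int (p := 1) (by norm_num) hη hM x) ?_
  filter_upwards with y
  simpa using st_oseen_le (x - y) (η y)

lemma st_pot_le {η : EE → EE} {M : ℝ} (hη : Integrable η)
    (hM : ∀ᵐ x, ‖η x‖ ≤ M) (x : EE) :
    ‖oseenPot η x‖ ≤ M * stκ 1 + ∫ y, ‖η y‖ :=
  (st_pot_le_int hη hM x).trans (st_conv_bound (by norm_num) hη hM x)

lemma st_ae_ne (x : EE) : ∀ᵐ y : EE, x - y ≠ 0 := by
  have : ∀ᵐ y : EE, y ≠ x := by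
    simp [ae_iff]
  filter_upwards [this] with y hy h
  exact hy (sub_eq_zero.1 h).symm

lemma st_pot_lip {η : EE → EE} {M : ℝ} (hη : Integrable η)
    (hM : ∀ᵐ x, ‖η x‖ ≤ M) (x y : EE) :
    ‖oseenPot η x - oseenPot η y‖ ≤ 6 * (M * stκ 2 + ∫ y, ‖η y‖) * ‖x - y‖ := by
  have ix := st_conv_int (p := 2) le_rfl hη hM x
  have iy := st_conv_int (p := 2) le_rfl hη hM y
  have h1 : ‖oseenPot η x - oseenPot η y‖ ≤ ∫ z, 3 * ‖x - y‖ *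
      ((‖x - z‖ ^ 2)⁻¹ * ‖η z‖ + (‖y - z‖ ^ 2)⁻¹ * ‖η z‖) := by
    unfold oseenPot
    rw [← integral_sub (st_pot_int hη hM x) (st_pot_int hη hM y)]
    refine norm_integral_le_of_norm_le ((ix.add iy).const_mul _) ?_
    filter_upwards [st_ae_ne x, st_ae_ne y] with z hx hy
    have := st_oseen_sub (x - z) (y - z) (η z) hx hy
    rwa [sub_sub_sub_cancel_right] at this
  rw [integral_const_mul, integral_add ix iy] at h1
  have bx := st_conv_bound (p := 2) le_rfl hη hM x
  have byy := st_conv_bound (p := 2) le_rfl hη hM y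
  have := norm_nonneg (x - y)
  nlinarith

lemma st_ptwise_decay (p : EE) {δ : ℝ} (h0 : 0 < δ) (h1 : δ ≤ 1) :
    (‖p‖ ^ 1)⁻¹ ≤ min ‖p‖⁻¹ δ⁻¹ + δ * stk 2 p := by
  have hk := stk_nonneg 2 p
  rw [pow_one]
  rcases le_or_gt δ ‖p‖ with h | h
  · rw [min_eq_left (by gcongr)]
    nlinarith
  · have hm : p ∈ Metric.ball (0 : EE) 1 := by simpa using h.trans_le h1
    rw [stk, Set.indicator_of_mem hm]
    rcases (norm_nonneg p).eq_or_lt with h' | h'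
    · simpa [← h'] using h0.le
    · have : ‖p‖⁻¹ ≤ δ * (‖p‖ ^ 2)⁻¹ := by
        have e : ‖p‖⁻¹ = ‖p‖ * (‖p‖ ^ 2)⁻¹ := by field_simp
        rw [e]; gcongr
      have : 0 ≤ min ‖p‖⁻¹ δ⁻¹ := by positivity
      linarith

lemma st_decay {η : EE → EE} {M : ℝ} (hη : Integrable η) (hM : ∀ᵐ x, ‖η x‖ ≤ M) :
    Tendsto (oseenPot η) (cocompact _) (nhds 0) := by
  have hM0 := st_M_nonneg hM
  have hκ := stκ_nonneg 2
  have : (cocompact EE).IsCountablyGenerated := by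
    rw [← Metric.cobounded_eq_cocompact, ← comap_norm_atTop]; infer_instance
  have far : ∀ δ : ℝ, 0 < δ → Tendsto (fun x : EE => ∫ y, min ‖x - y‖⁻¹ δ⁻¹ * ‖η y‖)
      (cocompact _) (nhds 0) := by
    intro δ hδ
    have : Tendsto (fun x : EE => ∫ y, min ‖x - y‖⁻¹ δ⁻¹ * ‖η y‖)
      (cocompact _) (nhds (∫ y : EE, (0 : ℝ))) := by
      refine tendsto_integral_filter_of_dominated_convergence (fun y => δ⁻¹ * ‖η y‖) ?_ ?_
        (hη.norm.const_mul _) ?_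
      · filter_upwards with x
        exact (by fun_prop : Measurable fun y : EE =>
          min ‖x - y‖⁻¹ δ⁻¹).aestronglyMeasurable.mul hη.aestronglyMeasurable.norm
      · filter_upwards with x
        filter_upwards with y
        rw [Real.norm_of_nonneg (by positivity)]
        gcongr
        exact min_le_right _ _
      · filter_upwards with y
        have h1 : Tendsto (fun x : EE => ‖x - y‖) (cocompact _) atTop := by
          refine tendsto_atTop_mono (fun x => norm_sub_norm_le x y) ?_
          exact tendsto_atTop_add_const_right _ _ (tendsto_norm_cocompact_atTop)
        have h2 := tendsto_inv_atTop_zero.comp h1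
        have h3 : Tendsto (fun x : EE => ‖x - y‖⁻¹ * ‖η y‖) (cocompact _) (nhds 0) := by
          simpa using h2.mul_const ‖η y‖
        refine squeeze_zero (fun x => by positivity) (fun x => ?_) h3
        gcongr
        exact min_le_left _ _
    simpa using this
  have main : ∀ δ : ℝ, 0 < δ → δ ≤ 1 → ∀ x : EE,
      ‖oseenPot η x‖ ≤ (∫ y, min ‖x - y‖⁻¹ δ⁻¹ * ‖η y‖) + δ * (M * stκ 2) := by
    intro δ h0 h1 x
    refine (st_pot_le_int hη hM x).trans ?_
    have i1 : Integrable (fun y => min ‖x - y‖⁻¹ δ⁻¹ * ‖η y‖) := by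
      refine Integrable.mono' (hη.norm.const_mul δ⁻¹) ?_ ?_
      · exact (by fun_prop : Measurable fun y : EE =>
          min ‖x - y‖⁻¹ δ⁻¹).aestronglyMeasurable.mul hη.aestronglyMeasurable.norm
      · filter_upwards with y
        rw [Real.norm_of_nonneg (by positivity)]
        gcongr
        exact min_le_right _ _
    have i2 := ((st_near_int (p := 2) le_rfl x).const_mul M).const_mul δ
    have : ∫ y, (‖x - y‖ ^ 1)⁻¹ * ‖η y‖ ≤ ∫ y, (min ‖x - y‖⁻¹ δ⁻¹ * ‖η y‖
        + δ * (M * stk 2 (x - y))) := by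
      refine integral_mono_ae (st_conv_int (by norm_num) hη hM x) (i1.add i2) ?_
      filter_upwards [hM] with y hy
      have a := st_ptwise_decay (x - y) h0 h1
      have b := stk_nonneg 2 (x - y)
      calc _ ≤ (min ‖x - y‖⁻¹ δ⁻¹ + δ * stk 2 (x - y)) * ‖η y‖ := by gcongr
        _ = min ‖x - y‖⁻¹ δ⁻¹ * ‖η y‖ + δ * (‖η y‖ * stk 2 (x - y)) := by ring
        _ ≤ _ := by gcongr
    rwa [integral_add i1 i2, integral_const_mul, integral_const_mul, st_near_integral] at this
  rw [tendsto_zero_iff_norm_tendsto_zero]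
  rw [Metric.tendsto_nhds]
  intro ε hε
  set A := M * stκ 2 with hA
  have hA0 : 0 ≤ A := by positivity
  set δ := min 1 (ε / (2 * (A + 1))) with hδ
  have hδ0 : 0 < δ := by positivity
  have hδA : δ * A < ε / 2 := by
    have : δ ≤ ε / (2 * (A + 1)) := min_le_right _ _
    calc δ * A < δ * (A + 1) := by nlinarith
      _ ≤ ε / (2 * (A + 1)) * (A + 1) := by gcongr
      _ = ε / 2 := by field_simp
  have := (far δ hδ0).eventually_lt_const (half_pos hε)
  filter_upwards [this] with x hx
  have h := main δ hδ0 (min_le_left _ _) x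
  rw [dist_zero_right, norm_norm]
  linarith


/-! ### Fubini -/

lemma st_fubini {η : EE → EE} {M : ℝ} (hη : Integrable η) (hM : ∀ᵐ x, ‖η x‖ ≤ M)
    {g : EE → EE} (hg : Continuous g) (hgc : HasCompactSupport g) :
    ∫ x, ⟪oseenPot η x, g x⟫ = ∫ y, ∫ x, ⟪oseen (x - y) (η y), g x⟫ := by
  have hgi : Integrable g := hg.integrable_of_hasCompactSupport hgc
  have hmeas : AEStronglyMeasurable (fun q : EE × EE => ⟪oseen (q.1 - q.2) (η q.2), g q.1⟫)
      (volume.prod volume) := by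
    have h1 : AEMeasurable (fun q : EE × EE => η q.2) (volume.prod volume) :=
      hη.aestronglyMeasurable.aemeasurable.comp_quasiMeasurePreserving
        Measure.quasiMeasurePreserving_snd
    have h2 : AEMeasurable (fun q : EE × EE => (q.1 - q.2, η q.2)) (volume.prod volume) :=
      (by fun_prop : Measurable fun q : EE × EE => q.1 - q.2).aemeasurable.prodMk h1
    have h3 := st_oseen_meas.comp_aemeasurable h2
    have h4 : AEMeasurable (fun q : EE × EE => g q.1) (volume.prod volume) :=
      (hg.measurable.comp measurable_fst).aemeasurable
    exact (h3.inner h4).aestronglyMeasurable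
  have hle : ∀ x y, ‖⟪oseen (x - y) (η y), g x⟫‖ ≤ ((‖x - y‖ ^ 1)⁻¹ * ‖η y‖) * ‖g x‖ := by
    intro x y
    refine (norm_inner_le_norm _ _).trans ?_
    rw [pow_one]
    gcongr
    exact st_oseen_le _ _
  have hIntg : Integrable (fun q : EE × EE => ⟪oseen (q.1 - q.2) (η q.2), g q.1⟫)
      (volume.prod volume) := by
    rw [integrable_prod_iff hmeas]
    have hx : ∀ x, Integrable (fun y => ⟪oseen (x - y) (η y), g x⟫) := fun x =>
      (st_pot_int hη hM x).inner_const (g x)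
    refine ⟨Eventually.of_forall hx, ?_⟩
    refine Integrable.mono' (hgi.norm.const_mul (M * stκ 1 + ∫ y, ‖η y‖)) ?_ ?_
    · exact hmeas.norm.integral_prod_right'
    · filter_upwards with x
      rw [Real.norm_of_nonneg (integral_nonneg fun y => norm_nonneg _)]
      have i1 := st_conv_int (p := 1) (by norm_num) hη hM x
      calc _ ≤ ∫ y, ((‖x - y‖ ^ 1)⁻¹ * ‖η y‖) * ‖g x‖ :=
            integral_mono (hx x).norm (i1.mul_const _) (hle x)
        _ = (∫ y, (‖x - y‖ ^ 1)⁻¹ * ‖η y‖) * ‖g x‖ := integral_mul_const _ _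
        _ ≤ _ := by gcongr; exact st_conv_bound (by norm_num) hη hM x
  rw [← integral_integral_swap (f := fun x y => ⟪oseen (x - y) (η y), g x⟫) hIntg]
  congr 1
  ext x
  have := integral_inner (𝕜 := ℝ) (st_pot_int hη hM x) (g x)
  rw [real_inner_comm, oseenPot, ← this]
  congr 1
  ext y
  exact real_inner_comm _ _

/-! ### Partial derivatives -/

/-- standard basis vector -/
def stb (i : Fin 3) : EE := EuclideanSpace.single i 1

/-- partial derivative -/
def stD {F : Type*} [NormedAddCommGroup F] [NormedSpace ℝ F] (i : Fin 3) (f : EE → F) : EE → F :=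
  fun x => fderiv ℝ f x (stb i)

lemma stD_smooth {F : Type*} [NormedAddCommGroup F] [NormedSpace ℝ F] (i : Fin 3) {f : EE → F}
    (hf : ContDiff ℝ (⊤ : ℕ∞) f) : ContDiff ℝ (⊤ : ℕ∞) (stD i f) :=
  (hf.fderiv_right (m := (⊤ : ℕ∞)) (by simp)).clm_apply contDiff_const

lemma stD_supp {F : Type*} [NormedAddCommGroup F] [NormedSpace ℝ F] (i : Fin 3) {f : EE → F}
    (hf : HasCompactSupport f) : HasCompactSupport (stD i f) :=
  (hf.fderiv ℝ).comp_left (g := fun L : EE →L[ℝ] F => L (stb i)) rfl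

lemma stD_comm (i j : Fin 3) {f : EE → ℝ} (hf : ContDiff ℝ (⊤ : ℕ∞) f) :
    stD i (stD j f) = stD j (stD i f) := by
  have hd : Differentiable ℝ (fderiv ℝ f) :=
    (hf.fderiv_right (m := (⊤ : ℕ∞)) (by simp)).differentiable (by simp)
  have key : ∀ (a b : Fin 3) (x : EE), stD a (stD b f) x = fderiv ℝ (fderiv ℝ f) x (stb a) (stb b) := by
    intro a b x
    unfold stD
    rw [fderiv_clm_apply (hd x) (by fun_prop)]
    simp
  ext x
  rw [key, key]
  exact (hf.contDiffAt.isSymmSndFDerivAt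
    (by simp only [minSmoothness_of_isRCLikeNormedField]; exact WithTop.coe_le_coe.2 (le_top : (2 : ℕ∞) ≤ ⊤))) (stb i) (stb j)

lemma stD_comp (i k : Fin 3) {φ : EE → EE} (hφ : Differentiable ℝ φ) (x : EE) :
    stD i (fun z => φ z k) x = (stD i φ x) k := by
  unfold stD
  have := ((EuclideanSpace.proj k : EE →L[ℝ] ℝ).hasFDerivAt.comp x (hφ x).hasFDerivAt).fderiv
  have e : (fun z => φ z k) = (EuclideanSpace.proj k : EE →L[ℝ] ℝ) ∘ φ := rfl
  rw [e, this]; rfl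

lemma stD_add {f g : EE → ℝ} (i : Fin 3) (hf : Differentiable ℝ f) (hg : Differentiable ℝ g) :
    stD i (fun x => f x + g x) = fun x => stD i f x + stD i g x := by
  ext x; unfold stD
  rw [fderiv_fun_add (hf x) (hg x)]; rfl

/-- scalar Laplacian -/
def stL (f : EE → ℝ) : EE → ℝ := fun x => ∑ i, stD i (stD i f) x

lemma stL_smooth {f : EE → ℝ} (hf : ContDiff ℝ (⊤ : ℕ∞) f) : ContDiff ℝ (⊤ : ℕ∞) (stL f) :=
  ContDiff.sum fun i _ => stD_smooth i (stD_smooth i hf)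

lemma stL_supp {f : EE → ℝ} (hf : HasCompactSupport f) : HasCompactSupport (stL f) := by
  have h := fun i : Fin 3 => stD_supp i (stD_supp i hf)
  have : stL f = fun x => stD 0 (stD 0 f) x + stD 1 (stD 1 f) x + stD 2 (stD 2 f) x := by
    ext x; simp [stL, Fin.sum_univ_three]
  rw [this]
  exact ((h 0).add (h 1)).add (h 2)

lemma stD_sum {ι : Type*} (s : Finset ι) (i : Fin 3) {f : ι → EE → ℝ}
    (hf : ∀ k, ContDiff ℝ (⊤ : ℕ∞) (f k)) :
    stD i (fun x => ∑ k ∈ s, f k x) = fun x => ∑ k ∈ s, stD i (f k) x := by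
  ext x; unfold stD
  rw [fderiv_fun_sum (fun k _ => (hf k).differentiable (by simp) x)]
  simp

lemma st_div_lap {f : Fin 3 → EE → ℝ} (hf : ∀ k, ContDiff ℝ (⊤ : ℕ∞) (f k))
    (h0 : ∀ x, ∑ k, stD k (f k) x = 0) (x : EE) : ∑ k, stD k (stL (f k)) x = 0 := by
  have h1 : ∀ k, stD k (stL (f k)) x = ∑ i, stD i (stD i (stD k (f k))) x := by
    intro k
    unfold stL
    rw [stD_sum Finset.univ k (f := fun i => stD i (stD i (f k)))
      (fun i => stD_smooth i (stD_smooth i (hf k)))]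
    refine Finset.sum_congr rfl fun i _ => ?_
    rw [stD_comm k i (stD_smooth i (hf k)), stD_comm k i (hf k)]
  simp_rw [h1]
  rw [Finset.sum_comm]
  refine Finset.sum_eq_zero fun i _ => ?_
  have e1 := stD_sum Finset.univ i (f := fun k => stD k (f k)) (fun k => stD_smooth k (hf k))
  have e2 := stD_sum Finset.univ i (f := fun k => stD i (stD k (f k)))
    (fun k => stD_smooth i (stD_smooth k (hf k)))
  have e3 : (fun x => ∑ k, stD k (f k) x) = fun _ => (0 : ℝ) := funext h0
  have z : stD i (fun _ : EE => (0 : ℝ)) = fun _ => 0 := by ext y; simp [stD]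
  rw [e3, z] at e1
  rw [← e1, z] at e2
  exact (congrFun e2 x).symm


/-! ### Regularised kernels -/

def stN (ε : ℝ) (z : EE) : ℝ := √(‖z‖ ^ 2 + ε ^ 2)

lemma stN_sq (ε : ℝ) (z : EE) : stN ε z ^ 2 = ‖z‖ ^ 2 + ε ^ 2 := Real.sq_sqrt (by positivity)

lemma stN_pos {ε : ℝ} (hε : 0 < ε) (z : EE) : 0 < stN ε z := Real.sqrt_pos.2 (by positivity)

lemma stN_ge (ε : ℝ) (z : EE) : ‖z‖ ≤ stN ε z :=
  Real.le_sqrt_of_sq_le (by nlinarith [sq_nonneg ε])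

lemma stN_ge' {ε : ℝ} (z : EE) : ε ≤ stN ε z :=
  Real.le_sqrt_of_sq_le (by nlinarith [sq_nonneg ‖z‖])

lemma stN_cont (ε : ℝ) : Continuous (stN ε) := by unfold stN; fun_prop

lemma stN_tendsto (z : EE) : Tendsto (fun ε => stN ε z) (nhdsWithin 0 (Ioi 0)) (nhds ‖z‖) := by
  have : Continuous (fun ε => stN ε z) := by unfold stN; fun_prop
  have h := this.tendsto 0
  have e : stN 0 z = ‖z‖ := by simp [stN]
  rw [e] at h
  exact h.mono_left nhdsWithin_le_nhds

lemma stN_line {ε : ℝ} (hε : 0 < ε) (x e : EE) :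
    HasDerivAt (fun t : ℝ => stN ε (x + t • e)) (⟪x, e⟫ / stN ε x) 0 := by
  have h1 : HasDerivAt (fun t : ℝ => ‖x + t • e‖ ^ 2 + ε ^ 2) (2 * ⟪x, e⟫) 0 := by
    have h := ((hasDerivAt_id (0 : ℝ)).smul_const e).const_add x
    have h2 := h.norm_sq.add_const (ε ^ 2)
    simpa using h2
  have h2 := h1.sqrt (by simp; positivity)
  unfold stN
  convert h2 using 1
  simp
  field_simp

lemma stinv_line {ε : ℝ} (hε : 0 < ε) (k : ℕ) (x e : EE) :
    HasDerivAt (fun t : ℝ => (stN ε (x + t • e) ^ k)⁻¹) (-k * ⟪x, e⟫ * (stN ε x ^ (k + 2))⁻¹) 0 := by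
  have hp := stN_pos hε x
  have h := ((stN_line hε x e).fun_pow k).inv (by simpa using (pow_pos hp k).ne')
  refine h.congr_deriv ?_
  rcases k with _ | k
  · simp
  · simp only [zero_smul, add_zero, Nat.add_sub_cancel]
    field_simp
    ring

lemma stcoord_line (x e v : EE) : HasDerivAt (fun t : ℝ => ⟪x + t • e, v⟫) ⟪e, v⟫ 0 := by
  have h := ((hasDerivAt_id (0 : ℝ)).smul_const e).const_add x
  have h2 := h.inner ℝ (hasDerivAt_const (0 : ℝ) v)
  simpa using h2

/-- integration by parts against a test function -/
lemma st_ibp {f f' : EE → ℝ} (hf : Continuous f) (hf' : Continuous f') (i : Fin 3)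
    (hd : ∀ x, HasDerivAt (fun t : ℝ => f (x + t • stb i)) (f' x) 0)
    {g : EE → ℝ} (hg : ContDiff ℝ (⊤ : ℕ∞) g) (hgc : HasCompactSupport g) :
    ∫ x, f x * stD i g x = - ∫ x, f' x * g x := by
  have hDc := (stD_smooth i hg).continuous
  refine integral_bilinear_hasLineDerivAt_right_eq_neg_left_of_integrable
    (B := ContinuousLinearMap.mul ℝ ℝ) (v := stb i) (f := f) (f' := f') (g := g) (g' := stD i g)
    ?_ ?_ ?_ ?_ ?_
  · exact (hf'.mul hg.continuous).integrable_of_hasCompactSupport hgc.mul_left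
  · exact (hf.mul hDc).integrable_of_hasCompactSupport (stD_supp i hgc).mul_left
  · exact (hf.mul hg.continuous).integrable_of_hasCompactSupport hgc.mul_left
  · intro x _; exact hd x
  · intro x _
    exact ((hg.differentiable (by simp)) x).hasFDerivAt.hasLineDerivAt _

/-! ### Limits of kernel integrals -/

lemma st_ker_loc {p : ℕ} (hp : p ≤ 2) : LocallyIntegrable (fun z : EE => (‖z‖ ^ p)⁻¹) := by
  intro x
  refine ⟨Metric.ball 0 (‖x‖ + 1), Metric.isOpen_ball.mem_nhds (by simp), st_ker_int hp _⟩

lemma st_ker_mul_int {p : ℕ} (hp : p ≤ 2) {g : EE → ℝ} (hg : Continuous g)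
    (hgc : HasCompactSupport g) : Integrable (fun z : EE => (‖z‖ ^ p)⁻¹ * g z) := by
  have := (st_ker_loc hp).integrable_smul_right_of_hasCompactSupport hg hgc
  simpa using this

lemma st_ae_ne0 : ∀ᵐ z : EE, z ≠ 0 := by
  filter_upwards [st_ae_ne 0] with z hz h
  simp [h] at hz

lemma st_K_int {p : ℕ} (hp : p ≤ 2) {K : EE → ℝ} (hK : Measurable K) {C : ℝ}
    (hb : ∀ z, z ≠ 0 → |K z| ≤ C * (‖z‖ ^ p)⁻¹) {g : EE → ℝ} (hg : Continuous g)
    (hgc : HasCompactSupport g) : Integrable (fun z => K z * g z) := by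
  refine Integrable.mono' ((st_ker_mul_int hp hg.norm hgc.norm).const_mul C)
    (hK.aestronglyMeasurable.mul hg.aestronglyMeasurable) ?_
  filter_upwards [st_ae_ne0] with z hz
  rw [norm_mul, ← mul_assoc]
  gcongr
  exact hb z hz

lemma st_K_lim {p : ℕ} (hp : p ≤ 2) {K : ℝ → EE → ℝ} {K0 : EE → ℝ}
    (hK : ∀ ε, Measurable (K ε)) {C : ℝ}
    (hb : ∀ ε > 0, ∀ z, z ≠ 0 → |K ε z| ≤ C * (‖z‖ ^ p)⁻¹)
    (hl : ∀ z, z ≠ 0 → Tendsto (fun ε => K ε z) (nhdsWithin 0 (Ioi 0)) (nhds (K0 z)))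
    {g : EE → ℝ} (hg : Continuous g) (hgc : HasCompactSupport g) :
    Tendsto (fun ε => ∫ z, K ε z * g z) (nhdsWithin 0 (Ioi 0)) (nhds (∫ z, K0 z * g z)) := by
  refine tendsto_integral_filter_of_dominated_convergence
    (fun z => C * ((‖z‖ ^ p)⁻¹ * ‖g z‖)) ?_ ?_
    ((st_ker_mul_int hp hg.norm hgc.norm).const_mul C) ?_
  · filter_upwards with ε
    exact (hK ε).aestronglyMeasurable.mul hg.aestronglyMeasurable
  · filter_upwards [self_mem_nhdsWithin] with ε hε
    filter_upwards [st_ae_ne0] with z hz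
    rw [norm_mul, ← mul_assoc]
    gcongr
    exact hb ε hε z hz
  · filter_upwards [st_ae_ne0] with z hz
    exact (hl z hz).mul_const _

/-- The function `z ↦ z_j` written via inner products. -/
lemma st_coord (z : EE) (j : Fin 3) : ⟪z, stb j⟫ = z j := by
  rw [stb, EuclideanSpace.inner_single_right]; simp

lemma st_bb (j : Fin 3) : (stb j) j = (1 : ℝ) := by simp [stb]

lemma st_bv (j : Fin 3) (v : EE) : ⟪stb j, v⟫ = v j := by
  rw [real_inner_comm]; exact st_coord v j

lemma st_inner_sum (z v : EE) : ⟪z, v⟫ = ∑ j, z j * v j := by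
  simp [PiLp.inner_apply, mul_comm]

lemma st_coord_le (z : EE) (j : Fin 3) : |z j| ≤ ‖z‖ := by
  simpa using PiLp.norm_apply_le z j

lemma st_sum_sq (z : EE) : ∑ j, z j * z j = ‖z‖ ^ 2 := by
  rw [← st_inner_sum, real_inner_self_eq_norm_sq]

lemma st_invN_le (ε : ℝ) (k : ℕ) {z : EE} (hz : z ≠ 0) :
    (stN ε z ^ k)⁻¹ ≤ (‖z‖ ^ k)⁻¹ := by
  have : 0 < ‖z‖ := norm_pos_iff.2 hz
  have := stN_ge ε z
  gcongr

lemma st_invN_lim (k : ℕ) {z : EE} (hz : z ≠ 0) :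
    Tendsto (fun ε => (stN ε z ^ k)⁻¹) (nhdsWithin 0 (Ioi 0)) (nhds (‖z‖ ^ k)⁻¹) :=
  ((stN_tendsto z).pow k).inv₀ (pow_ne_zero _ (norm_ne_zero_iff.2 hz))

lemma st_invN_cont {ε : ℝ} (hε : 0 < ε) (k : ℕ) : Continuous (fun z => (stN ε z ^ k)⁻¹) :=
  ((stN_cont ε).pow k).inv₀ (fun z => (pow_pos (stN_pos hε z) k).ne')

lemma stN_meas (ε : ℝ) : Measurable (stN ε) := (stN_cont ε).measurable

lemma st_zz_le {ε : ℝ} (hε : 0 < ε) (v : EE) (j : Fin 3) {z : EE} (hz : z ≠ 0) :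
    |⟪z, v⟫ * z j * (stN ε z ^ 3)⁻¹| ≤ ‖v‖ * (‖z‖ ^ 1)⁻¹ := by
  have hz' : 0 < ‖z‖ := norm_pos_iff.2 hz
  have hN := stN_pos hε z
  rw [abs_mul, abs_mul, abs_of_pos (by positivity : 0 < (stN ε z ^ 3)⁻¹)]
  calc _ ≤ (‖z‖ * ‖v‖) * ‖z‖ * (‖z‖ ^ 3)⁻¹ := by
        gcongr
        · exact abs_real_inner_le_norm z v
        · exact st_coord_le z j
        · exact stN_ge ε z
    _ = _ := by field_simp

/-! ### The limits -/

lemma st_lim1 {g : EE → ℝ} (hg : Continuous g) (hgc : HasCompactSupport g) :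
    Tendsto (fun ε => ∫ z, (stN ε z ^ 1)⁻¹ * g z) (nhdsWithin 0 (Ioi 0))
      (nhds (∫ z, (‖z‖ ^ 1)⁻¹ * g z)) := by
  refine st_K_lim (p := 1) (C := 1) (by norm_num) (fun ε => ?_) (fun ε hε z hz => ?_)
    (fun z hz => st_invN_lim 1 hz) hg hgc
  · exact ((stN_meas ε).pow_const 1).inv
  · have := stN_pos hε z
    rw [abs_of_pos (by positivity), one_mul]
    exact st_invN_le ε 1 hz

lemma st_lim2 (v : EE) (j : Fin 3) {g : EE → ℝ} (hg : Continuous g) (hgc : HasCompactSupport g) :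
    Tendsto (fun ε => ∫ z, (⟪z, v⟫ * z j * (stN ε z ^ 3)⁻¹) * g z) (nhdsWithin 0 (Ioi 0))
      (nhds (∫ z, (⟪z, v⟫ * z j * (‖z‖ ^ 3)⁻¹) * g z)) := by
  refine st_K_lim (p := 1) (C := ‖v‖) (by norm_num) (fun ε => ?_)
    (fun ε hε z hz => st_zz_le hε v j hz)
    (fun z hz => (st_invN_lim 3 hz).const_mul _) hg hgc
  have := stN_meas ε
  fun_prop

lemma st_lim3 (v : EE) {g : EE → ℝ} (hg : Continuous g) (hgc : HasCompactSupport g) :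
    Tendsto (fun ε => ∫ z, (3 * ε ^ 2 * ⟪z, v⟫ * (stN ε z ^ 5)⁻¹) * g z) (nhdsWithin 0 (Ioi 0))
      (nhds 0) := by
  have := st_K_lim (p := 2) (C := 3 * ‖v‖) (K := fun ε z => 3 * ε ^ 2 * ⟪z, v⟫ * (stN ε z ^ 5)⁻¹)
    (K0 := fun _ => 0) (by norm_num) (fun ε => ?_)
    (fun ε hε z hz => ?_) (fun z hz => ?_) hg hgc
  · simpa using this
  · have := stN_meas ε
    fun_prop
  · have hz' : 0 < ‖z‖ := norm_pos_iff.2 hz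
    have hN := stN_pos hε z
    have h1 := stN_ge ε z
    have h2 : ε ≤ stN ε z := stN_ge' z
    rw [abs_mul, abs_mul, abs_of_pos (by positivity : 0 < (stN ε z ^ 5)⁻¹),
      abs_of_pos (by positivity)]
    have h3 := abs_real_inner_le_norm z v
    have hε' : 0 < ε := hε
    calc 3 * ε ^ 2 * |⟪z, v⟫| * (stN ε z ^ 5)⁻¹
        ≤ 3 * stN ε z ^ 2 * (‖z‖ * ‖v‖) * (stN ε z ^ 5)⁻¹ := by gcongr
      _ ≤ 3 * stN ε z ^ 2 * (stN ε z * ‖v‖) * (stN ε z ^ 5)⁻¹ := by gcongr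
      _ = 3 * ‖v‖ * (stN ε z ^ 2)⁻¹ := by field_simp
      _ ≤ _ := by gcongr
  · have h1 : Tendsto (fun ε : ℝ => 3 * ε ^ 2 * ⟪z, v⟫) (nhdsWithin 0 (Ioi 0)) (nhds 0) := by
      have : Continuous (fun ε : ℝ => 3 * ε ^ 2 * ⟪z, v⟫) := by fun_prop
      have h := this.tendsto 0
      simp only [ne_eq, OfNat.ofNat_ne_zero, not_false_eq_true, zero_pow, mul_zero, zero_mul] at h
      exact h.mono_left nhdsWithin_le_nhds
    simpa using h1.mul (st_invN_lim 5 hz)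

/-! ### Regularised integrations by parts -/

lemma st_reg1 {ε : ℝ} (hε : 0 < ε) (v : EE) (j : Fin 3) {g : EE → ℝ}
    (hg : ContDiff ℝ (⊤ : ℕ∞) g) (hgc : HasCompactSupport g) :
    ∫ z, (v j * (stN ε z ^ 1)⁻¹ - ⟪z, v⟫ * z j * (stN ε z ^ 3)⁻¹) * g z
      = - ∫ z, (⟪z, v⟫ * (stN ε z ^ 1)⁻¹) * stD j g z := by
  rw [st_ibp (f := fun z => ⟪z, v⟫ * (stN ε z ^ 1)⁻¹)
    (f' := fun z => v j * (stN ε z ^ 1)⁻¹ - ⟪z, v⟫ * z j * (stN ε z ^ 3)⁻¹) ?_ ?_ j ?_ hg hgc,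
    neg_neg]
  · have := st_invN_cont hε 1; fun_prop
  · have := st_invN_cont hε 1; have := st_invN_cont hε 3; fun_prop
  · intro x
    have h := (stcoord_line x (stb j) v).mul (stinv_line hε 1 x (stb j))
    refine h.congr_deriv ?_
    simp only [zero_smul, add_zero, st_coord, st_bv]
    push_cast; ring

lemma st_reg2 {ε : ℝ} (hε : 0 < ε) (j : Fin 3) {g : EE → ℝ}
    (hg : ContDiff ℝ (⊤ : ℕ∞) g) (hgc : HasCompactSupport g) :
    ∫ z, (stN ε z ^ 1)⁻¹ * stD j g z = ∫ z, (z j * (stN ε z ^ 3)⁻¹) * g z := by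
  rw [st_ibp (f := fun z => (stN ε z ^ 1)⁻¹)
    (f' := fun z => - (z j * (stN ε z ^ 3)⁻¹)) ?_ ?_ j ?_ hg hgc]
  · simp_rw [neg_mul]; rw [integral_neg, neg_neg]
  · exact st_invN_cont hε 1
  · have := st_invN_cont hε 3; fun_prop
  · intro x
    have h := (stinv_line hε 1 x (stb j))
    refine h.congr_deriv ?_
    simp only [st_coord]
    push_cast; ring

lemma st_reg3 {ε : ℝ} (hε : 0 < ε) (j : Fin 3) {g : EE → ℝ}
    (hg : ContDiff ℝ (⊤ : ℕ∞) g) (hgc : HasCompactSupport g) :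
    ∫ z, (z j * (stN ε z ^ 3)⁻¹) * stD j g z =
      - ∫ z, ((stN ε z ^ 3)⁻¹ - 3 * (z j * z j) * (stN ε z ^ 5)⁻¹) * g z := by
  rw [st_ibp (f := fun z => (z j * (stN ε z ^ 3)⁻¹))
    (f' := fun z => ((stN ε z ^ 3)⁻¹ - 3 * (z j * z j) * (stN ε z ^ 5)⁻¹)) ?_ ?_ j ?_ hg hgc]
  · have := st_invN_cont hε 3; fun_prop
  · have := st_invN_cont hε 3; have := st_invN_cont hε 5; fun_prop
  · intro x
    have h := (stcoord_line x (stb j) (stb j)).mul (stinv_line hε 3 x (stb j))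
    simp only [st_coord, st_bb] at h
    refine h.congr_deriv ?_
    simp only [zero_smul, add_zero]
    push_cast; ring

lemma st_reg4 {ε : ℝ} (hε : 0 < ε) (v : EE) (j : Fin 3) {g : EE → ℝ}
    (hg : ContDiff ℝ (⊤ : ℕ∞) g) (hgc : HasCompactSupport g) :
    ∫ z, (v j * (stN ε z ^ 1)⁻¹ + ⟪z, v⟫ * z j * (stN ε z ^ 3)⁻¹) * stD j g z =
      - ∫ z, (⟪z, v⟫ * (stN ε z ^ 3)⁻¹ - 3 * ⟪z, v⟫ * (z j * z j) * (stN ε z ^ 5)⁻¹) * g z := by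
  rw [st_ibp (f := fun z => (v j * (stN ε z ^ 1)⁻¹ + ⟪z, v⟫ * z j * (stN ε z ^ 3)⁻¹))
    (f' := fun z => (⟪z, v⟫ * (stN ε z ^ 3)⁻¹ - 3 * ⟪z, v⟫ * (z j * z j) * (stN ε z ^ 5)⁻¹))
    ?_ ?_ j ?_ hg hgc]
  · have := st_invN_cont hε 1; have := st_invN_cont hε 3; fun_prop
  · have := st_invN_cont hε 3; have := st_invN_cont hε 5; fun_prop
  · intro x
    have h := ((stinv_line hε 1 x (stb j)).const_mul (v j)).add
      (((stcoord_line x (stb j) v).mul (stcoord_line x (stb j) (stb j))).mul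
        (stinv_line hε 3 x (stb j)))
    simp only [st_coord, st_bb, st_bv] at h
    refine h.congr_deriv ?_
    simp only [Pi.mul_apply, zero_smul, add_zero]
    push_cast; ring


/-! ### The Newtonian potential -/

lemma st_radial : ∫ r in Ioi (0 : ℝ), r ^ 2 * (√(r ^ 2 + 1) ^ 5)⁻¹ = 1 / 3 := by
  have hd : ∀ x ∈ Ici (0 : ℝ), HasDerivAt (fun r : ℝ => r ^ 3 * (√(r ^ 2 + 1) ^ 3)⁻¹ / 3)
      (x ^ 2 * (√(x ^ 2 + 1) ^ 5)⁻¹) x := by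
    intro x _
    have hp : 0 < x ^ 2 + 1 := by positivity
    have hs : 0 < √(x ^ 2 + 1) := Real.sqrt_pos.2 hp
    have h1 : HasDerivAt (fun r : ℝ => r ^ 2 + 1) (2 * x) x := by
      simpa using (hasDerivAt_pow 2 x).add_const 1
    have h2 := ((h1.sqrt hp.ne').fun_pow 3).inv (pow_pos hs 3).ne'
    have h3 := ((hasDerivAt_pow 3 x).mul h2).div_const 3
    refine h3.congr_deriv ?_
    have e : √(x ^ 2 + 1) ^ 2 = x ^ 2 + 1 := Real.sq_sqrt hp.le
    set s := √(x ^ 2 + 1)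
    simp only [Pi.inv_apply]
    push_cast
    field_simp
    linear_combination (x ^ 2 * s ^ 3) * e
  have hl : Tendsto (fun r : ℝ => r ^ 3 * (√(r ^ 2 + 1) ^ 3)⁻¹ / 3) atTop (nhds (1 / 3)) := by
    have h0 : Tendsto (fun r : ℝ => 1 + (r⁻¹) ^ 2) atTop (nhds 1) := by
      simpa using (tendsto_inv_atTop_zero.pow 2).const_add (1 : ℝ)
    have h1 : Tendsto (fun r : ℝ => (√(1 + (r⁻¹) ^ 2) ^ 3)⁻¹ / 3) atTop (nhds (1 / 3)) := by
      have := (((Real.continuous_sqrt.tendsto 1).comp h0).pow 3).inv₀ (by simp)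
      simpa using this.div_const 3
    refine h1.congr' ?_
    filter_upwards [eventually_gt_atTop 0] with r hr
    have e : √(r ^ 2 + 1) = r * √(1 + (r⁻¹) ^ 2) := by
      rw [show r ^ 2 + 1 = r ^ 2 * (1 + (r⁻¹) ^ 2) by field_simp,
        Real.sqrt_mul (by positivity), Real.sqrt_sq hr.le]
    rw [e]
    have : 0 < √(1 + (r⁻¹) ^ 2) := Real.sqrt_pos.2 (by positivity)
    field_simp
  have := integral_Ioi_of_hasDerivAt_of_nonneg' hd (fun x _ => by positivity) hl
  rw [this]; simp

def stpeak (z : EE) : ℝ := 3 / (4 * π) * (√(‖z‖ ^ 2 + 1) ^ 5)⁻¹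

lemma stpeak_integral : ∫ z, stpeak z = 1 := by
  unfold stpeak
  rw [integral_const_mul,
    integral_fun_norm_addHaar volume (fun r : ℝ => (√(r ^ 2 + 1) ^ 5)⁻¹), st_finrank]
  have hb : (volume : Measure EE).real (Metric.ball 0 1) = 4 / 3 * π := by
    rw [Measure.real, EuclideanSpace.volume_ball_fin_three]
    simp
    rw [ENNReal.toReal_ofReal (by positivity)]
    ring
  have := st_radial
  simp only [smul_eq_mul, nsmul_eq_mul, hb]
  norm_num only [Nat.reduceSub] at this ⊢
  rw [this]
  have := Real.pi_pos
  field_simp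

lemma stpeak_decay : Tendsto (fun x : EE => ‖x‖ ^ Module.finrank ℝ EE * stpeak x)
    (Bornology.cobounded EE) (nhds 0) := by
  have h1 : Tendsto (fun x : EE => 3 / (4 * π) * (‖x‖⁻¹) ^ 2) (Bornology.cobounded EE) (nhds 0) := by
    have := ((tendsto_inv_atTop_zero.comp (tendsto_norm_cobounded_atTop (E := EE))).pow 2).const_mul
      (3 / (4 * π))
    simpa using this
  refine squeeze_zero (fun x => by unfold stpeak; positivity) (fun x => ?_) h1
  rw [st_finrank]
  unfold stpeak
  rcases eq_or_ne x 0 with rfl | hx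
  · simp
  have hx' : 0 < ‖x‖ := norm_pos_iff.2 hx
  have h2 : ‖x‖ ≤ √(‖x‖ ^ 2 + 1) := Real.le_sqrt_of_sq_le (by linarith)
  calc _ ≤ ‖x‖ ^ 3 * (3 / (4 * π) * (‖x‖ ^ 5)⁻¹) := by gcongr
    _ = _ := by field_simp

lemma stpeak_scale {ε : ℝ} (hε : 0 < ε) (z : EE) :
    3 * ε ^ 2 * (stN ε z ^ 5)⁻¹ = 4 * π * ((ε⁻¹) ^ Module.finrank ℝ EE * stpeak (ε⁻¹ • z)) := by
  have e : √(‖ε⁻¹ • z‖ ^ 2 + 1) = ε⁻¹ * stN ε z := by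
    rw [norm_smul, Real.norm_of_nonneg (by positivity), stN,
      show (ε⁻¹ * ‖z‖) ^ 2 + 1 = (ε⁻¹) ^ 2 * (‖z‖ ^ 2 + ε ^ 2) by field_simp,
      Real.sqrt_mul (by positivity), Real.sqrt_sq (by positivity)]
  rw [stpeak, e, st_finrank]
  have := stN_pos hε z
  have := Real.pi_pos
  field_simp

lemma st_cc_int {f g : EE → ℝ} (hf : Continuous f) (hg : Continuous g)
    (hgc : HasCompactSupport g) : Integrable (fun z => f z * g z) :=
  (hf.mul hg).integrable_of_hasCompactSupport hgc.mul_left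

lemma st_newton {g : EE → ℝ} (hg : ContDiff ℝ (⊤ : ℕ∞) g) (hgc : HasCompactSupport g) :
    ∫ z, (‖z‖ ^ 1)⁻¹ * stL g z = - (4 * π * g 0) := by
  have h1 := st_lim1 (stL_smooth hg).continuous (stL_supp hgc)
  have h2 : Tendsto (fun ε : ℝ => - (4 * π * ∫ z, ((ε⁻¹) ^ Module.finrank ℝ EE *
      stpeak (ε⁻¹ • z)) • g z)) (nhdsWithin 0 (Ioi 0)) (nhds (- (4 * π * g 0))) := by
    have hpk : ∀ x, 0 ≤ stpeak x := fun x => by unfold stpeak; positivity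
    have := tendsto_integral_comp_smul_smul_of_integrable (μ := volume) hpk stpeak_integral
      stpeak_decay (hg.continuous.integrable_of_hasCompactSupport hgc) hg.continuous.continuousAt
    exact ((this.comp tendsto_inv_nhdsGT_zero).const_mul (4 * π)).neg
  refine tendsto_nhds_unique h1 (h2.congr' ?_)
  filter_upwards [self_mem_nhdsWithin] with ε hε
  have hε : 0 < ε := hε
  have c1 := st_invN_cont hε 1
  have c3 := st_invN_cont hε 3
  have c5 := st_invN_cont hε 5
  have s1 : ∫ z, (stN ε z ^ 1)⁻¹ * stL g z = ∑ i, ∫ z, (stN ε z ^ 1)⁻¹ * stD i (stD i g) z := by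
    rw [← integral_finsetSum]
    · simp_rw [stL, Finset.mul_sum]
    · intro i _
      exact st_cc_int c1 (stD_smooth i (stD_smooth i hg)).continuous (stD_supp i (stD_supp i hgc))
  have s2 : ∀ i : Fin 3, ∫ z, (stN ε z ^ 1)⁻¹ * stD i (stD i g) z =
      - ∫ z, ((stN ε z ^ 3)⁻¹ - 3 * (z i * z i) * (stN ε z ^ 5)⁻¹) * g z := by
    intro i
    rw [st_reg2 hε i (stD_smooth i hg) (stD_supp i hgc), st_reg3 hε i hg hgc]
  rw [s1]
  simp_rw [s2]
  rw [Finset.sum_neg_distrib, neg_inj, ← integral_finsetSum, ← integral_const_mul]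
  · congr 1
    ext z
    rw [smul_eq_mul, ← mul_assoc, ← stpeak_scale hε z, ← Finset.sum_mul]
    congr 1
    rw [Finset.sum_sub_distrib, ← Finset.sum_mul, ← Finset.mul_sum, st_sum_sq]
    have hN := stN_pos hε z
    have hq := stN_sq ε z
    simp only [Finset.sum_const, Finset.card_univ, Fintype.card_fin, nsmul_eq_mul]
    push_cast
    field_simp
    linear_combination -hq
  · intro i _
    exact st_cc_int (by fun_prop) hg.continuous hgc

/-! ### The Oseen identities -/

lemma st_oseen_inner (z v w : EE) : ⟪oseen z v, w⟫ =
    (8 * π)⁻¹ * ∑ j, (v j * (‖z‖ ^ 1)⁻¹ + ⟪z, v⟫ * z j * (‖z‖ ^ 3)⁻¹) * w j := by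
  rw [oseen, real_inner_smul_left, inner_add_left, real_inner_smul_left, real_inner_smul_left,
    real_inner_smul_left, st_inner_sum v w, st_inner_sum z w]
  congr 1
  rw [Finset.mul_sum, Finset.mul_sum, Finset.mul_sum, ← Finset.sum_add_distrib]
  refine Finset.sum_congr rfl fun j _ => ?_
  rw [pow_one]; ring

lemma st_zz_le0 (v : EE) (j : Fin 3) {z : EE} (hz : z ≠ 0) :
    |⟪z, v⟫ * z j * (‖z‖ ^ 3)⁻¹| ≤ ‖v‖ * (‖z‖ ^ 1)⁻¹ := by
  have hz' : 0 < ‖z‖ := norm_pos_iff.2 hz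
  rw [abs_mul, abs_mul, abs_of_pos (by positivity : 0 < (‖z‖ ^ 3)⁻¹)]
  calc _ ≤ (‖z‖ * ‖v‖) * ‖z‖ * (‖z‖ ^ 3)⁻¹ := by
        gcongr
        · exact abs_real_inner_le_norm z v
        · exact st_coord_le z j
    _ = _ := by field_simp

lemma st_zz_int (v : EE) (j : Fin 3) {g : EE → ℝ} (hg : Continuous g)
    (hgc : HasCompactSupport g) : Integrable (fun z => (⟪z, v⟫ * z j * (‖z‖ ^ 3)⁻¹) * g z) :=
  st_K_int (p := 1) (C := ‖v‖) (by norm_num) (by fun_prop) (fun _ hz => st_zz_le0 v j hz) hg hgc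

lemma st_z1_int {g : EE → ℝ} (hg : Continuous g)
    (hgc : HasCompactSupport g) : Integrable (fun z => (‖z‖ ^ 1)⁻¹ * g z) :=
  st_ker_mul_int (by norm_num) hg hgc

lemma st_O_split (v : EE) (j : Fin 3) {g : EE → ℝ} (hg : Continuous g)
    (hgc : HasCompactSupport g) :
    Integrable (fun z => (v j * (‖z‖ ^ 1)⁻¹ + ⟪z, v⟫ * z j * (‖z‖ ^ 3)⁻¹) * g z) ∧
    ∫ z, (v j * (‖z‖ ^ 1)⁻¹ + ⟪z, v⟫ * z j * (‖z‖ ^ 3)⁻¹) * g z =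
      v j * (∫ z, (‖z‖ ^ 1)⁻¹ * g z) + ∫ z, (⟪z, v⟫ * z j * (‖z‖ ^ 3)⁻¹) * g z := by
  have i1 := (st_z1_int hg hgc).const_mul (v j)
  have i2 := st_zz_int v j hg hgc
  have e : (fun z : EE => (v j * (‖z‖ ^ 1)⁻¹ + ⟪z, v⟫ * z j * (‖z‖ ^ 3)⁻¹) * g z) =
      fun z => v j * ((‖z‖ ^ 1)⁻¹ * g z) + (⟪z, v⟫ * z j * (‖z‖ ^ 3)⁻¹) * g z := by
    ext z; ring
  rw [e]
  exact ⟨i1.add i2, by rw [integral_add i1 i2, integral_const_mul]⟩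

lemma st_oseen_int_sum (v : EE) {w : EE → EE} {g : Fin 3 → EE → ℝ} (hw : ∀ z j, w z j = g j z)
    (hg : ∀ j, Continuous (g j)) (hgc : ∀ j, HasCompactSupport (g j)) :
    ∫ z, ⟪oseen z v, w z⟫ = (8 * π)⁻¹ * ∑ j, (v j * (∫ z, (‖z‖ ^ 1)⁻¹ * g j z)
      + ∫ z, (⟪z, v⟫ * z j * (‖z‖ ^ 3)⁻¹) * g j z) := by
  simp_rw [st_oseen_inner, hw]
  rw [integral_const_mul, integral_finsetSum _ fun j _ => (st_O_split v j (hg j) (hgc j)).1]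
  congr 1
  exact Finset.sum_congr rfl fun j _ => (st_O_split v j (hg j) (hgc j)).2

lemma st_grad_zero (v : EE) {g : EE → ℝ} (hg : ContDiff ℝ (⊤ : ℕ∞) g)
    (hgc : HasCompactSupport g) {w : EE → EE} (hw : ∀ z j, w z j = stD j g z) :
    ∫ z, ⟪oseen z v, w z⟫ = 0 := by
  have cD := fun j => (stD_smooth j hg).continuous
  have sD := fun j => stD_supp j hgc
  rw [st_oseen_int_sum v hw cD sD]
  refine mul_eq_zero_of_right _ ?_
  have lim : Tendsto (fun ε => ∑ j, (v j * (∫ z, (stN ε z ^ 1)⁻¹ * stD j g z)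
      + ∫ z, (⟪z, v⟫ * z j * (stN ε z ^ 3)⁻¹) * stD j g z)) (nhdsWithin 0 (Ioi 0))
      (nhds (∑ j, (v j * (∫ z, (‖z‖ ^ 1)⁻¹ * stD j g z)
      + ∫ z, (⟪z, v⟫ * z j * (‖z‖ ^ 3)⁻¹) * stD j g z))) :=
    tendsto_finsetSum _ fun j _ =>
      ((st_lim1 (cD j) (sD j)).const_mul _).add (st_lim2 v j (cD j) (sD j))
  have lim0 := (st_lim3 v hg.continuous hgc).neg
  rw [neg_zero] at lim0
  refine tendsto_nhds_unique lim (lim0.congr' ?_)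
  filter_upwards [self_mem_nhdsWithin] with ε hε
  have hε : 0 < ε := hε
  have c1 := st_invN_cont hε 1
  have c3 := st_invN_cont hε 3
  have c5 := st_invN_cont hε 5
  have s1 : ∀ j : Fin 3, v j * (∫ z, (stN ε z ^ 1)⁻¹ * stD j g z)
      + ∫ z, (⟪z, v⟫ * z j * (stN ε z ^ 3)⁻¹) * stD j g z =
      - ∫ z, (⟪z, v⟫ * (stN ε z ^ 3)⁻¹ - 3 * ⟪z, v⟫ * (z j * z j) * (stN ε z ^ 5)⁻¹) * g z := by
    intro j
    rw [← st_reg4 hε v j hg hgc, ← integral_const_mul, ← integral_add]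
    · congr 1; ext z; ring
    · exact (st_cc_int c1 (cD j) (sD j)).const_mul _
    · exact st_cc_int (by fun_prop) (cD j) (sD j)
  simp_rw [s1]
  rw [Finset.sum_neg_distrib, neg_inj, ← integral_finsetSum]
  · congr 1
    ext z
    rw [← Finset.sum_mul]
    congr 1
    rw [Finset.sum_sub_distrib, ← Finset.sum_mul, ← Finset.sum_mul, ← Finset.mul_sum, st_sum_sq]
    have hN := stN_pos hε z
    have hq := stN_sq ε z
    simp only [Finset.sum_const, Finset.card_univ, Fintype.card_fin, nsmul_eq_mul]
    push_cast
    field_simp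
    linear_combination -(⟪z, v⟫) * hq
  · intro i _
    exact st_cc_int (by fun_prop) hg.continuous hgc

lemma st_hess_zero (v : EE) {g : Fin 3 → EE → ℝ} (hg : ∀ j, ContDiff ℝ (⊤ : ℕ∞) (g j))
    (hgc : ∀ j, HasCompactSupport (g j)) (h0 : ∀ x, ∑ j, stD j (g j) x = 0) :
    ∑ j, (v j * (∫ z, (‖z‖ ^ 1)⁻¹ * g j z)
      - ∫ z, (⟪z, v⟫ * z j * (‖z‖ ^ 3)⁻¹) * g j z) = 0 := by
  have cD := fun j => (hg j).continuous
  have lim : Tendsto (fun ε => ∑ j, (v j * (∫ z, (stN ε z ^ 1)⁻¹ * g j z)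
      - ∫ z, (⟪z, v⟫ * z j * (stN ε z ^ 3)⁻¹) * g j z)) (nhdsWithin 0 (Ioi 0))
      (nhds (∑ j, (v j * (∫ z, (‖z‖ ^ 1)⁻¹ * g j z)
      - ∫ z, (⟪z, v⟫ * z j * (‖z‖ ^ 3)⁻¹) * g j z))) :=
    tendsto_finsetSum _ fun j _ =>
      ((st_lim1 (cD j) (hgc j)).const_mul _).sub (st_lim2 v j (cD j) (hgc j))
  refine tendsto_nhds_unique lim (tendsto_const_nhds.congr' ?_)
  filter_upwards [self_mem_nhdsWithin] with ε hε
  have hε : 0 < ε := hε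
  have c1 := st_invN_cont hε 1
  have c3 := st_invN_cont hε 3
  have s1 : ∀ j : Fin 3, v j * (∫ z, (stN ε z ^ 1)⁻¹ * g j z)
      - ∫ z, (⟪z, v⟫ * z j * (stN ε z ^ 3)⁻¹) * g j z =
      - ∫ z, (⟪z, v⟫ * (stN ε z ^ 1)⁻¹) * stD j (g j) z := by
    intro j
    rw [← st_reg1 hε v j (hg j) (hgc j), ← integral_const_mul, ← integral_sub]
    · congr 1; ext z; ring
    · exact (st_cc_int c1 (cD j) (hgc j)).const_mul _
    · exact st_cc_int (by fun_prop) (cD j) (hgc j)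
  simp_rw [s1]
  rw [Finset.sum_neg_distrib, ← integral_finsetSum]
  · simp_rw [← Finset.mul_sum, h0]
    simp
  · intro j _
    exact st_cc_int (by fun_prop) (stD_smooth j (hg j)).continuous (stD_supp j (hgc j))

lemma st_lap_id (v : EE) {f : Fin 3 → EE → ℝ} (hf : ∀ j, ContDiff ℝ (⊤ : ℕ∞) (f j))
    (hfc : ∀ j, HasCompactSupport (f j)) (h0 : ∀ x, ∑ j, stD j (f j) x = 0)
    {w : EE → EE} (hw : ∀ z j, w z j = stL (f j) z) :
    ∫ z, ⟪oseen z v, w z⟫ = - ∑ j, v j * f j 0 := by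
  rw [st_oseen_int_sum v hw (fun j => (stL_smooth (hf j)).continuous) (fun j => stL_supp (hfc j))]
  have hz := st_hess_zero v (fun j => stL_smooth (hf j)) (fun j => stL_supp (hfc j))
    (st_div_lap hf h0)
  have hn := fun j => st_newton (hf j) (hfc j)
  simp_rw [hn] at hz ⊢
  have := Real.pi_pos
  simp only [Fin.sum_univ_three] at hz ⊢
  generalize (∫ z, (⟪z, v⟫ * z 0 * (‖z‖ ^ 3)⁻¹) * stL (f 0) z) = I0 at hz ⊢
  generalize (∫ z, (⟪z, v⟫ * z 1 * (‖z‖ ^ 3)⁻¹) * stL (f 1) z) = I1 at hz ⊢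
  generalize (∫ z, (⟪z, v⟫ * z 2 * (‖z‖ ^ 3)⁻¹) * stL (f 2) z) = I2 at hz ⊢
  field_simp
  linear_combination -hz


/-! ### Translation -/

lemma st_translate (v y : EE) (G : EE → EE) :
    ∫ x, ⟪oseen (x - y) v, G x⟫ = ∫ z, ⟪oseen z v, G (z + y)⟫ := by
  have := integral_sub_right_eq_self (μ := volume) (fun z => ⟪oseen z v, G (z + y)⟫) y
  rw [← this]
  simp

lemma stD_shift {g : EE → ℝ} (j : Fin 3) (y : EE) :
    stD j (fun z => g (z + y)) = fun z => stD j g (z + y) := by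
  ext z; unfold stD; rw [fderiv_comp_add_right]

lemma stL_shift {g : EE → ℝ} (y : EE) :
    stL (fun z => g (z + y)) = fun z => stL g (z + y) := by
  ext z; unfold stL
  simp_rw [stD_shift]

lemma st_shift_smooth {g : EE → ℝ} (hg : ContDiff ℝ (⊤ : ℕ∞) g) (y : EE) :
    ContDiff ℝ (⊤ : ℕ∞) (fun z => g (z + y)) := hg.comp (contDiff_id.add contDiff_const)

lemma st_shift_supp {g : EE → ℝ} (hg : HasCompactSupport g) (y : EE) :
    HasCompactSupport (fun z => g (z + y)) :=
  hg.comp_homeomorph (Homeomorph.addRight y)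

/-! ### Divergence free -/

lemma st_grad_coord (φ : EE → ℝ) (x : EE) (j : Fin 3) : gradient φ x j = stD j φ x := by
  rw [← st_coord, gradient, InnerProductSpace.toDual_symm_apply]; rfl

lemma st_div_free {η : EE → EE} {M : ℝ} (hη : Integrable η) (hM : ∀ᵐ x, ‖η x‖ ≤ M)
    {φ : EE → ℝ} (hφ : ContDiff ℝ (⊤ : ℕ∞) φ) (hc : HasCompactSupport φ) :
    ∫ x, ⟪oseenPot η x, gradient φ x⟫ = 0 := by
  have h1 : Continuous (gradient φ) :=
    (InnerProductSpace.toDual ℝ EE).symm.continuous.comp (hφ.continuous_fderiv (by simp))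
  have h2 : HasCompactSupport (gradient φ) :=
    (hc.fderiv ℝ).comp_left (g := (InnerProductSpace.toDual ℝ EE).symm) (map_zero _)
  rw [st_fubini hη hM h1 h2]
  have : ∀ y, ∫ x, ⟪oseen (x - y) (η y), gradient φ x⟫ = 0 := by
    intro y
    rw [st_translate]
    refine st_grad_zero (η y) (st_shift_smooth hφ y) (st_shift_supp hc y) ?_
    intro z j
    rw [st_grad_coord, stD_shift]
  simp only [this, integral_zero]

/-! ### The weak formulation -/

def stW (φ : EE → EE) (x : EE) : EE := WithLp.toLp 2 (fun j => stL (fun z => φ z j) x)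

lemma st_comp_smooth {φ : EE → EE} (hφ : ContDiff ℝ (⊤ : ℕ∞) φ) (j : Fin 3) :
    ContDiff ℝ (⊤ : ℕ∞) (fun z => φ z j) :=
  (EuclideanSpace.proj j : EE →L[ℝ] ℝ).contDiff.comp hφ

lemma st_comp_supp {φ : EE → EE} (hc : HasCompactSupport φ) (j : Fin 3) :
    HasCompactSupport (fun z => φ z j) :=
  hc.comp_left (g := fun w : EE => w j) rfl

lemma stW_cont {φ : EE → EE} (hφ : ContDiff ℝ (⊤ : ℕ∞) φ) : Continuous (stW φ) := by
  have : ∀ j, Continuous (stL (fun z => φ z j)) := fun j =>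
    (stL_smooth (st_comp_smooth hφ j)).continuous
  unfold stW
  exact (PiLp.continuous_toLp 2 _).comp (continuous_pi this)

lemma stW_supp {φ : EE → EE} (hc : HasCompactSupport φ) : HasCompactSupport (stW φ) := by
  have h := fun j : Fin 3 => stL_supp (st_comp_supp hc j)
  refine HasCompactSupport.intro ((((h 0).union (h 1)).union (h 2)) : IsCompact _) ?_
  intro x hx
  simp only [mem_union, not_or] at hx
  ext j
  fin_cases j
  · exact image_eq_zero_of_notMem_tsupport (f := stL (fun z => φ z 0)) hx.1.1
  · exact image_eq_zero_of_notMem_tsupport (f := stL (fun z => φ z 1)) hx.1.2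
  · exact image_eq_zero_of_notMem_tsupport (f := stL (fun z => φ z 2)) hx.2

lemma st_weak_rhs {η : EE → EE} {M : ℝ} (hη : Integrable η) (hM : ∀ᵐ x, ‖η x‖ ≤ M)
    {φ : EE → EE} (hφ : ContDiff ℝ (⊤ : ℕ∞) φ) (hc : HasCompactSupport φ)
    (h0 : ∀ x, divg φ x = 0) :
    ∫ x, ⟪oseenPot η x, stW φ x⟫ = - ∫ x, ⟪η x, φ x⟫ := by
  rw [st_fubini hη hM (stW_cont hφ) (stW_supp hc), ← integral_neg]
  congr 1
  ext y
  rw [st_translate]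
  have hdiv : ∀ x, ∑ j, stD j (fun z => φ z j) x = 0 := by
    intro x
    rw [← h0 x, divg]
    refine Finset.sum_congr rfl fun j _ => ?_
    rw [stD_comp j j (hφ.differentiable (by simp)), ← st_coord]; rfl
  rw [st_lap_id (η y) (f := fun j z => φ (z + y) j)
    (fun j => st_shift_smooth (st_comp_smooth hφ j) y)
    (fun j => st_shift_supp (st_comp_supp hc j) y) ?_ ?_]
  · simp [st_inner_sum]
  · intro x
    have : ∀ j : Fin 3, stD j (fun z => φ (z + y) j) x = stD j (fun z => φ z j) (x + y) := fun j =>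
      congrFun (stD_shift (g := fun z => φ z j) j y) x
    simp_rw [this]
    exact hdiv _
  · intro z j
    exact (congrFun (stL_shift (g := fun z => φ z j) y) z).symm

lemma st_ld_int {K : NNReal} {f : EE → ℝ} (hf : LipschitzWith K f) (e : EE) {g : EE → ℝ}
    (hg : Continuous g) (hgc : HasCompactSupport g) :
    Integrable (fun x => lineDeriv ℝ f x e * g x) := by
  have := (hf.locallyIntegrable_lineDeriv (μ := volume) e).integrable_smul_right_of_hasCompactSupport
    hg hgc
  simpa using this

lemma st_weak_lhs {K : NNReal} {u : EE → EE} (hu : LipschitzWith K u)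
    {φ : EE → EE} (hφ : ContDiff ℝ (⊤ : ℕ∞) φ) (hc : HasCompactSupport φ) :
    ∫ x, ∑ i : Fin 3, ⟪fderiv ℝ u x (EuclideanSpace.single i 1),
      fderiv ℝ φ x (EuclideanSpace.single i 1)⟫ = - ∫ x, ⟪u x, stW φ x⟫ := by
  have huk : ∀ k : Fin 3, LipschitzWith K (fun x => u x k) := by
    intro k
    refine LipschitzWith.of_dist_le_mul fun x y => ?_
    refine le_trans ?_ (hu.dist_le_mul x y)
    rw [Real.dist_eq, dist_eq_norm]
    exact st_coord_le (u x - u y) k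
  have sm := fun k => st_comp_smooth hφ k
  have sc := fun k => st_comp_supp hc k
  have e1 : ∫ x, ∑ i : Fin 3, ⟪fderiv ℝ u x (EuclideanSpace.single i 1),
      fderiv ℝ φ x (EuclideanSpace.single i 1)⟫ =
      ∫ x, ∑ i : Fin 3, ∑ k : Fin 3, lineDeriv ℝ (fun x => u x k) x (stb i) *
        stD i (fun z => φ z k) x := by
    refine integral_congr_ae ?_
    filter_upwards [hu.ae_differentiableAt (μ := volume)] with x hx
    refine Finset.sum_congr rfl fun i _ => ?_
    rw [st_inner_sum]
    refine Finset.sum_congr rfl fun k _ => ?_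
    rw [stD_comp i k (hφ.differentiable (by simp))]
    congr 1
    have h := ((EuclideanSpace.proj k : EE →L[ℝ] ℝ).hasFDerivAt.comp x hx.hasFDerivAt)
    exact (h.hasLineDerivAt (stb i)).lineDeriv.symm
  have e2 : ∀ i k : Fin 3, ∫ x, lineDeriv ℝ (fun x => u x k) x (stb i) * stD i (fun z => φ z k) x
      = - ∫ x, u x k * stD i (stD i (fun z => φ z k)) x := by
    intro i k
    have s1 := stD_smooth i (sm k)
    have c1 := stD_supp i (sc k)
    obtain ⟨D, hD⟩ := (s1.of_le (m := 1) (by simp)).lipschitzWith_of_hasCompactSupport c1 (by simp)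
    rw [(huk k).integral_lineDeriv_mul_eq hD c1, ← integral_neg]
    congr 1
    ext x
    rw [(s1.differentiable (by simp) x).lineDeriv_eq_fderiv, map_neg]
    simp only [stD]
    ring
  have i2 : ∀ i k : Fin 3, Integrable (fun x => u x k * stD i (stD i (fun z => φ z k)) x) :=
    fun i k => st_cc_int (huk k).continuous (stD_smooth i (stD_smooth i (sm k))).continuous
      (stD_supp i (stD_supp i (sc k)))
  have i1 : ∀ i k : Fin 3, Integrable (fun x => lineDeriv ℝ (fun x => u x k) x (stb i) *
      stD i (fun z => φ z k) x) := fun i k =>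
    st_ld_int (huk k) _ (stD_smooth i (sm k)).continuous (stD_supp i (sc k))
  have e3 : ∀ x, ⟪u x, stW φ x⟫ = ∑ i : Fin 3, ∑ k : Fin 3,
      u x k * stD i (stD i (fun z => φ z k)) x := by
    intro x
    rw [st_inner_sum, Finset.sum_comm]
    refine Finset.sum_congr rfl fun k _ => ?_
    rw [← Finset.mul_sum]; rfl
  rw [e1]
  simp_rw [e3]
  rw [integral_finsetSum _ fun i _ => integrable_finsetSum _ fun k _ => i1 i k,
    integral_finsetSum _ fun i _ => integrable_finsetSum _ fun k _ => i2 i k,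
    ← Finset.sum_neg_distrib]
  refine Finset.sum_congr rfl fun i _ => ?_
  rw [integral_finsetSum _ fun k _ => i1 i k, integral_finsetSum _ fun k _ => i2 i k,
    ← Finset.sum_neg_distrib]
  exact Finset.sum_congr rfl fun k _ => e2 i k


theorem steady_stokes_wellposedness :
    ∃ C > 0, ∀ (η : EuclideanSpace ℝ (Fin 3) → EuclideanSpace ℝ (Fin 3)) (M : ℝ),
      Integrable η → (∀ᵐ x, ‖η x‖ ≤ M) →
      -- u(x) is well defined for every x
      (∀ x, Integrable fun y => oseen (x - y) (η y)) ∧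
      -- decay at infinity
      Filter.Tendsto (oseenPot η) (Filter.cocompact _) (nhds 0) ∧
      -- div u = 0 in the sense of distributions
      (∀ φ : EuclideanSpace ℝ (Fin 3) → ℝ, ContDiff ℝ (⊤ : ℕ∞) φ → HasCompactSupport φ →
        (∫ x, ⟪oseenPot η x, gradient φ x⟫) = 0) ∧
      -- weak form of −Δu + ∇p = η against divergence-free test fields: ∫ ∇u : ∇φ = ∫ η · φ
      (∀ φ : EuclideanSpace ℝ (Fin 3) → EuclideanSpace ℝ (Fin 3),
        ContDiff ℝ (⊤ : ℕ∞) φ → HasCompactSupport φ → (∀ x, divg φ x = 0) →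
        (∫ x, ∑ i : Fin 3,
            ⟪fderiv ℝ (oseenPot η) x (EuclideanSpace.single i 1),
              fderiv ℝ φ x (EuclideanSpace.single i 1)⟫)
          = ∫ x, ⟪η x, φ x⟫) ∧
      -- u ∈ W^{1,∞} with the quantitative bound ‖u‖_∞ + ‖∇u‖_∞ ≤ C (‖η‖_{L¹} + ‖η‖_{L∞})
      (∀ x, ‖oseenPot η x‖ ≤ C * ((∫ y, ‖η y‖) + M)) ∧
      (∀ x y, ‖oseenPot η x - oseenPot η y‖ ≤ C * ((∫ z, ‖η z‖) + M) * ‖x - y‖) := by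

  have k1 := stκ_nonneg 1
  have k2 := stκ_nonneg 2
  refine ⟨6 * (1 + stκ 1 + stκ 2), by positivity, ?_⟩
  intro η M hη hM
  have hM0 := st_M_nonneg hM
  have hI : 0 ≤ ∫ y, ‖η y‖ := integral_nonneg fun y => norm_nonneg _
  have lip : ∀ x y, ‖oseenPot η x - oseenPot η y‖ ≤
      6 * (1 + stκ 1 + stκ 2) * ((∫ z, ‖η z‖) + M) * ‖x - y‖ := by
    intro x y
    refine (st_pot_lip hη hM x y).trans ?_
    gcongr ?_ * _
    have h1 := mul_nonneg k1 hM0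
    have h2 := mul_nonneg k1 hI
    have h3 := mul_nonneg k2 hI
    nlinarith
  refine ⟨st_pot_int hη hM, st_decay hη hM, fun φ hφ hc => st_div_free hη hM hφ hc, ?_, ?_, lip⟩
  · intro φ hφ hc h0
    have hu : LipschitzWith (Real.toNNReal (6 * (1 + stκ 1 + stκ 2) * ((∫ z, ‖η z‖) + M)))
        (oseenPot η) := by
      refine LipschitzWith.of_dist_le_mul fun x y => ?_
      rw [dist_eq_norm, dist_eq_norm, Real.coe_toNNReal _ (by positivity)]
      exact lip x y
    rw [st_weak_lhs hu hφ hc, st_weak_rhs hη hM hφ hc h0, neg_neg]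
  · intro x
    refine (st_pot_le hη hM x).trans ?_
    have h1 := mul_nonneg k1 hM0
    have h2 := mul_nonneg k1 hI
    have h3 := mul_nonneg k2 hI
    have h4 := mul_nonneg k2 hM0
    nlinarith
end
end
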